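/- Fix c > 1, η_trn > 0, a positive integer r, and an invertible r×r diagonal matrix Σ with positive diagonal entries. For each N, let d = d(N) satisfy d(N)/N → c, let A_N be a d×N random matrix with i.i.d. Gaussian entries of mean 0 and variance η_trn²/d, let U_N be a d×r matrix with U_N^T U_N = I_r, let V_N be an N×r matrix with V_N^T V_N = I_r, set X_N = U_N Σ V_N^T, and let W_N = X_N ((X_N + A_N)^T (X_N + A_N))^{-1} (X_N + A_N)^T. Then lim_{N→∞} E[‖W_N‖_F²] = (c/(c−1)) · Tr(Σ² (Σ² + η_trn² I_r)^{-1}). -/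

import Mathlib

open MeasureTheory ProbabilityTheory Matrix Filter

instance matrixMeasurableSpace {m n α : Type*} [MeasurableSpace α] :
    MeasurableSpace (Matrix m n α) :=
  inferInstanceAs (MeasurableSpace (m → n → α))

/-- The law of a `d × N` random matrix with i.i.d. real Gaussian entries of mean `0`
and variance `v`. -/
noncomputable def gaussMatrix (d N : ℕ) (v : NNReal) : Measure (Matrix (Fin d) (Fin N) ℝ) :=
  Measure.pi fun _ : Fin d => Measure.pi fun _ : Fin N => gaussianReal 0 v

/-- `W = X ((X+A)ᵀ(X+A))⁻¹ (X+A)ᵀ`, i.e. `X (X+A)†` when `X+A` has full column rank. -/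
noncomputable def Wmat {d N : ℕ} (X A : Matrix (Fin d) (Fin N) ℝ) :
    Matrix (Fin d) (Fin d) ℝ :=
  X * (((X + A)ᵀ * (X + A))⁻¹ * (X + A)ᵀ)

/-- The squared Frobenius norm `‖M‖_F² = ∑ᵢⱼ Mᵢⱼ²`. -/
def frobSq {m n : ℕ} (M : Matrix (Fin m) (Fin n) ℝ) : ℝ :=
  ∑ i, ∑ j, (M i j) ^ 2

instance isProbabilityMeasure_gaussMatrix (d N : ℕ) (v : NNReal) :
    IsProbabilityMeasure (gaussMatrix d N v) := by
  exact inferInstanceAs (IsProbabilityMeasure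
    (Measure.pi fun _ : Fin d => Measure.pi fun _ : Fin N => gaussianReal 0 v))

theorem measurable_matrix_entry {m n : Type*} (i : m) (j : n) :
    Measurable fun A : Matrix m n ℝ => A i j :=
  (measurable_pi_apply j).comp (measurable_pi_apply (X := fun _ : m => n → ℝ) i)

theorem measurable_matrix_of_entries {α m n : Type*} [MeasurableSpace α] {f : α → Matrix m n ℝ}
    (h : ∀ i j, Measurable fun a => f a i j) : Measurable f :=
  measurable_pi_iff.2 fun i => measurable_pi_iff.2 fun j => h i j

theorem Measurable.matrix_entry {α m n : Type*} [MeasurableSpace α] {f : α → Matrix m n ℝ}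
    (hf : Measurable f) (i : m) (j : n) : Measurable fun a => f a i j :=
  (measurable_matrix_entry i j).comp hf

theorem Measurable.matrix_mul {α l m n : Type*} [Fintype m] [MeasurableSpace α]
    {f : α → Matrix l m ℝ} {g : α → Matrix m n ℝ} (hf : Measurable f) (hg : Measurable g) :
    Measurable fun a => f a * g a := by
  refine measurable_matrix_of_entries fun i j => ?_
  simp only [Matrix.mul_apply]
  exact Finset.measurable_sum _ fun k _ => (hf.matrix_entry i k).mul (hg.matrix_entry k j)

theorem Measurable.matrix_transpose {α m n : Type*} [MeasurableSpace α]
    {f : α → Matrix m n ℝ} (hf : Measurable f) : Measurable fun a => (f a)ᵀ :=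
  measurable_matrix_of_entries fun i j => hf.matrix_entry j i

theorem Measurable.matrix_add {α m n : Type*} [MeasurableSpace α]
    {f g : α → Matrix m n ℝ} (hf : Measurable f) (hg : Measurable g) :
    Measurable fun a => f a + g a :=
  measurable_matrix_of_entries fun i j => (hf.matrix_entry i j).add (hg.matrix_entry i j)

theorem Measurable.matrix_sub {α m n : Type*} [MeasurableSpace α]
    {f g : α → Matrix m n ℝ} (hf : Measurable f) (hg : Measurable g) :
    Measurable fun a => f a - g a :=
  measurable_matrix_of_entries fun i j => (hf.matrix_entry i j).sub (hg.matrix_entry i j)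

theorem Measurable.matrix_det {α n : Type*} [Fintype n] [DecidableEq n] [MeasurableSpace α]
    {f : α → Matrix n n ℝ} (hf : Measurable f) : Measurable fun a => (f a).det := by
  simp only [Matrix.det_apply']
  exact Finset.measurable_sum _ fun s _ =>
    measurable_const.mul (Finset.measurable_prod _ fun k _ => hf.matrix_entry _ _)

theorem Measurable.matrix_inv {α n : Type*} [Fintype n] [DecidableEq n] [MeasurableSpace α]
    {f : α → Matrix n n ℝ} (hf : Measurable f) : Measurable fun a => (f a)⁻¹ := by
  refine measurable_matrix_of_entries fun i j => ?_
  simp only [Matrix.inv_def, Ring.inverse_eq_inv', Matrix.smul_apply, smul_eq_mul]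
  refine hf.matrix_det.inv.mul ?_
  simp only [Matrix.adjugate_apply]
  refine Measurable.matrix_det (measurable_matrix_of_entries fun k l => ?_)
  by_cases h : k = j
  · subst h; simp
  · simpa [Matrix.updateRow_ne h] using hf.matrix_entry k l

theorem charFun_map_toLp_pi_gaussianReal {n : ℕ} (v : NNReal) (t : EuclideanSpace ℝ (Fin n)) :
    charFun ((Measure.pi fun _ : Fin n => gaussianReal 0 v).map (WithLp.toLp 2)) t =
      Complex.exp (-(v * ‖t‖ ^ 2 / 2)) := by
  simp_rw [charFun_pi, charFun_gaussianReal, ← Complex.exp_sum, ← Complex.ofReal_pow,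
    EuclideanSpace.real_norm_sq_eq]
  simp [Finset.mul_sum, Finset.sum_div]

theorem map_mulVec_pi_gaussianReal {n : ℕ} (v : NNReal) (O : Matrix (Fin n) (Fin n) ℝ)
    (hO : O ∈ Matrix.orthogonalGroup (Fin n) ℝ) :
    (Measure.pi fun _ : Fin n => gaussianReal 0 v).map (fun x => O *ᵥ x) =
      Measure.pi fun _ : Fin n => gaussianReal 0 v := by
  have hm : Measurable fun x : Fin n → ℝ => O *ᵥ x := by fun_prop
  apply (MeasurableEquiv.toLp 2 (Fin n → ℝ)).map_measurableEquiv_injective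
  rw [MeasurableEquiv.coe_toLp]
  rw [Measure.map_map (by fun_prop) hm]
  have : IsProbabilityMeasure ((Measure.pi fun _ : Fin n => gaussianReal 0 v).map
    (WithLp.toLp 2 ∘ fun x => O *ᵥ x)) := Measure.isProbabilityMeasure_map (by fun_prop)
  have : IsProbabilityMeasure ((Measure.pi fun _ : Fin n => gaussianReal 0 v).map
    (WithLp.toLp 2)) := Measure.isProbabilityMeasure_map (by fun_prop)
  apply Measure.ext_of_charFun (E := EuclideanSpace ℝ (Fin n))
  ext t
  rw [charFun_map_toLp_pi_gaussianReal]
  have key : charFun ((Measure.pi fun _ : Fin n => gaussianReal 0 v).map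
      (WithLp.toLp 2 ∘ fun x => O *ᵥ x)) t =
      charFun ((Measure.pi fun _ : Fin n => gaussianReal 0 v).map (WithLp.toLp 2))
        (WithLp.toLp 2 (Oᵀ *ᵥ t.ofLp)) := by
    rw [charFun_apply, charFun_apply, integral_map (by fun_prop) (by fun_prop),
      integral_map (by fun_prop) (by fun_prop)]
    refine integral_congr_ae (ae_of_all _ fun x => ?_)
    simp only [Function.comp, EuclideanSpace.inner_eq_star_dotProduct, star_trivial]
    rw [Matrix.dotProduct_mulVec, Matrix.mulVec_transpose]
  rw [key, charFun_map_toLp_pi_gaussianReal]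
  have : ‖(WithLp.toLp 2 (Oᵀ *ᵥ t.ofLp) : EuclideanSpace ℝ (Fin n))‖ ^ 2 = ‖t‖ ^ 2 := by
    have h2 : O * Oᵀ = 1 := by
      have := (Matrix.mem_orthogonalGroup_iff (Fin n) ℝ).1 hO
      simpa [Matrix.star_eq_conjTranspose] using this
    rw [← real_inner_self_eq_norm_sq, ← real_inner_self_eq_norm_sq]
    simp only [EuclideanSpace.inner_eq_star_dotProduct, star_trivial]
    rw [Matrix.dotProduct_mulVec, Matrix.vecMul_transpose, Matrix.mulVec_mulVec, h2,
      Matrix.one_mulVec]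
  rw [← Complex.ofReal_pow, this, Complex.ofReal_pow]

theorem map_mul_right_gaussMatrix {d N : ℕ} (v : NNReal) (P : Matrix (Fin N) (Fin N) ℝ)
    (hP : P ∈ Matrix.orthogonalGroup (Fin N) ℝ) :
    (gaussMatrix d N v).map (fun A => A * P) = gaussMatrix d N v := by
  have hP' : Pᵀ ∈ Matrix.orthogonalGroup (Fin N) ℝ := by
    rw [Matrix.mem_orthogonalGroup_iff]
    have := (Matrix.mem_orthogonalGroup_iff' (Fin N) ℝ).1 hP
    simpa [Matrix.star_eq_conjTranspose] using this
  have h := map_mulVec_pi_gaussianReal v _ hP'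
  have := Measure.pi_map_pi (ι := Fin d) (μ := fun _ => Measure.pi fun _ : Fin N => gaussianReal 0 v)
    (f := fun _ x => Pᵀ *ᵥ x) (hμ := fun _ => by rw [h]; infer_instance)
    (fun _ => by fun_prop)
  rw [h] at this
  have hfun : (fun A : Matrix (Fin d) (Fin N) ℝ => A * P) = fun A i => Pᵀ *ᵥ A i := by
    ext A i j
    simp [Matrix.mul_apply, Matrix.mulVec, dotProduct, mul_comm]
  rw [hfun]
  exact this

theorem map_transpose_gaussMatrix (d N : ℕ) (v : NNReal) :
    (gaussMatrix d N v).map (fun A => Aᵀ) = gaussMatrix N d v := by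
  have hm : ∀ m n : ℕ, Measurable fun (x : Fin m × Fin n → ℝ) =>
      (Matrix.of fun i j => x (i, j)) := fun m n =>
    measurable_matrix_of_entries fun i j => measurable_pi_apply (i, j)
  have h1 : ∀ m n : ℕ, gaussMatrix m n v = (Measure.pi fun _ : Fin m × Fin n =>
      gaussianReal 0 v).map fun x => (Matrix.of fun i j => x (i, j)) := by
    intro m n
    have := Measure.infinitePi_map_curry (ι := Fin m) (κ := Fin n) (X := ℝ)
      (fun _ _ => gaussianReal 0 v)
    simp only [Measure.infinitePi_eq_pi] at this
    exact this.symm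
  have h2 := Measure.pi_map_piCongrLeft (Equiv.prodComm (Fin d) (Fin N))
    (β := fun _ => ℝ) (fun _ => gaussianReal 0 v)
  have ht : Measurable fun A : Matrix (Fin d) (Fin N) ℝ => Aᵀ := measurable_id.matrix_transpose
  rw [h1, h1, Measure.map_map ht (hm d N)]
  conv_rhs => rw [← h2]
  rw [Measure.map_map (hm N d) (MeasurableEquiv.measurable _)]
  rfl

theorem map_mul_left_gaussMatrix {d N : ℕ} (v : NNReal) (O : Matrix (Fin d) (Fin d) ℝ)
    (hO : O ∈ Matrix.orthogonalGroup (Fin d) ℝ) :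
    (gaussMatrix d N v).map (fun A => O * A) = gaussMatrix d N v := by
  have hO' : Oᵀ ∈ Matrix.orthogonalGroup (Fin d) ℝ := by
    rw [Matrix.mem_orthogonalGroup_iff]
    have := (Matrix.mem_orthogonalGroup_iff' (Fin d) ℝ).1 hO
    simpa [Matrix.star_eq_conjTranspose] using this
  have ht : Measurable fun A : Matrix (Fin N) (Fin d) ℝ => Aᵀ := measurable_id.matrix_transpose
  have hr : Measurable fun A : Matrix (Fin N) (Fin d) ℝ => A * Oᵀ :=
    measurable_id.matrix_mul measurable_const
  have hl : Measurable fun A : Matrix (Fin d) (Fin N) ℝ => O * A :=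
    measurable_const.matrix_mul measurable_id
  conv_rhs => rw [← map_transpose_gaussMatrix N d v, ← map_mul_right_gaussMatrix v _ hO',
    Measure.map_map ht hr]
  rw [← map_transpose_gaussMatrix N d v, Measure.map_map hl ht]
  congr 1
  ext A : 1
  simp [Matrix.transpose_mul]

theorem integral_exp_neg_mul_add_sq_gaussianReal {v : NNReal} (hv : v ≠ 0) {t : ℝ} (ht : 0 ≤ t)
    (m : ℝ) :
    ∫ x, Real.exp (-(t * (m + x) ^ 2)) ∂(gaussianReal 0 v) =
      (√(1 + 2 * t * v))⁻¹ * Real.exp (-(t * m ^ 2 / (1 + 2 * t * v))) := by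
  have hv0 : (0 : ℝ) < v := by positivity
  have ha : 0 < 1 + 2 * t * (v : ℝ) := by positivity
  rw [integral_gaussianReal_eq_integral_smul hv]
  have h1 : ∀ x : ℝ, gaussianPDFReal 0 v x • Real.exp (-(t * (m + x) ^ 2)) =
      ((√(2 * Real.pi * v))⁻¹ * Real.exp (-(t * m ^ 2 / (1 + 2 * t * v)))) *
      Real.exp (-((1 + 2 * t * v) / (2 * v)) * (x + 2 * t * v * m / (1 + 2 * t * v)) ^ 2) := by
    intro x
    rw [gaussianPDFReal_def, smul_eq_mul, mul_assoc (√(2 * Real.pi * v))⁻¹, ← Real.exp_add,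
      mul_assoc (√(2 * Real.pi * v))⁻¹, ← Real.exp_add]
    congr 2
    field_simp
    ring
  simp_rw [h1]
  rw [integral_const_mul, integral_add_right_eq_self
    (fun x : ℝ => Real.exp (-((1 + 2 * t * v) / (2 * v)) * x ^ 2)), integral_gaussian]
  have h2 : Real.pi / ((1 + 2 * t * (v : ℝ)) / (2 * v)) = (2 * Real.pi * v) / (1 + 2 * t * v) := by
    field_simp
  rw [h2, Real.sqrt_div (by positivity)]
  have h3 : √(2 * Real.pi * (v : ℝ)) ≠ 0 := by positivity
  field_simp

theorem integral_exp_neg_projection_form {n m : ℕ} {v : NNReal} (hv : v ≠ 0) {t : ℝ} (ht : 0 ≤ t)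
    {Q : Matrix (Fin n) (Fin n) ℝ} (hQs : Qᵀ = Q) (hQi : Q * Q = Q) (hQt : Q.trace = m)
    (b : Fin n → ℝ) :
    ∫ x, Real.exp (-(t * ((b + x) ⬝ᵥ Q *ᵥ (b + x))))
        ∂(Measure.pi fun _ : Fin n => gaussianReal 0 v) =
      (√(1 + 2 * t * v))⁻¹ ^ m * Real.exp (-(t * (b ⬝ᵥ Q *ᵥ b) / (1 + 2 * t * v))) := by
  have hH : Q.IsHermitian := by rw [Matrix.IsHermitian, Matrix.conjTranspose_eq_transpose_of_trivial, hQs]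
  set O : Matrix (Fin n) (Fin n) ℝ := hH.eigenvectorUnitary.1 with hOdef
  set l := hH.eigenvalues with hl
  have hO : O ∈ Matrix.orthogonalGroup (Fin n) ℝ := hH.eigenvectorUnitary.2
  have hO1 : O * Oᵀ = 1 := by
    have := (Matrix.mem_orthogonalGroup_iff (Fin n) ℝ).1 hO
    simpa [Matrix.star_eq_conjTranspose] using this
  have hO2 : Oᵀ * O = 1 := by
    have := (Matrix.mem_orthogonalGroup_iff' (Fin n) ℝ).1 hO
    simpa [Matrix.star_eq_conjTranspose] using this
  have hspec : Q = O * diagonal l * Oᵀ := by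
    have := hH.spectral_theorem
    rw [Unitary.conjStarAlgAut_apply, Matrix.star_eq_conjTranspose,
      Matrix.conjTranspose_eq_transpose_of_trivial] at this
    exact this
  have hD : diagonal l = Oᵀ * Q * O := by
    rw [hspec]
    calc diagonal l = (Oᵀ * O) * diagonal l * (Oᵀ * O) := by rw [hO2]; simp
      _ = _ := by simp only [Matrix.mul_assoc]
  have hll : ∀ k, l k = 0 ∨ l k = 1 := by
    intro k
    have h1 : diagonal l * diagonal l = diagonal l := by
      rw [hD]
      calc Oᵀ * Q * O * (Oᵀ * Q * O) = Oᵀ * (Q * (O * Oᵀ) * Q) * O := by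
            simp only [Matrix.mul_assoc]
        _ = Oᵀ * Q * O := by rw [hO1, Matrix.mul_one, hQi]
    have h2 := congrFun (congrFun h1 k) k
    rw [Matrix.diagonal_mul_diagonal, Matrix.diagonal_apply_eq, Matrix.diagonal_apply_eq] at h2
    have : l k * (l k - 1) = 0 := by linarith
    rcases mul_eq_zero.1 this with h | h
    · exact Or.inl h
    · exact Or.inr (by linarith)
  have hsum : ∑ k, l k = m := by
    rw [← hQt, hspec, Matrix.trace_mul_comm, ← Matrix.mul_assoc, hO2, Matrix.one_mul,
      Matrix.trace_diagonal]
  have hform : ∀ y : Fin n → ℝ, y ⬝ᵥ Q *ᵥ y = ∑ k, l k * (Oᵀ *ᵥ y) k ^ 2 := by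
    intro y
    rw [hspec, ← Matrix.mulVec_mulVec, ← Matrix.mulVec_mulVec, Matrix.dotProduct_mulVec,
      ← Matrix.mulVec_transpose, dotProduct]
    refine Finset.sum_congr rfl fun k _ => ?_
    rw [Matrix.mulVec_diagonal]; ring
  have hmap := map_mulVec_pi_gaussianReal v O hO
  rw [← hmap, integral_map (by fun_prop) (by fun_prop)]
  have h1 : ∀ y : Fin n → ℝ, Real.exp (-(t * ((b + O *ᵥ y) ⬝ᵥ Q *ᵥ (b + O *ᵥ y)))) =
      ∏ k, Real.exp (-((t * l k) * ((Oᵀ *ᵥ b) k + y k) ^ 2)) := by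
    intro y
    rw [← Real.exp_sum, hform, Matrix.mulVec_add, Matrix.mulVec_mulVec, hO2, Matrix.one_mulVec,
      Finset.mul_sum, ← Finset.sum_neg_distrib]
    simp only [Pi.add_apply, mul_assoc]
  simp_rw [h1]
  rw [integral_fintype_prod_eq_prod
    (f := fun k x => Real.exp (-((t * l k) * ((Oᵀ *ᵥ b) k + x) ^ 2)))]
  have h2 : ∀ k, ∫ x, Real.exp (-((t * l k) * ((Oᵀ *ᵥ b) k + x) ^ 2)) ∂(gaussianReal 0 v) =
      Real.exp (l k * Real.log (√(1 + 2 * t * v))⁻¹ +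
        -(t * (l k * (Oᵀ *ᵥ b) k ^ 2) / (1 + 2 * t * v))) := by
    intro k
    have hp : 0 < (√(1 + 2 * t * (v : ℝ)))⁻¹ := by positivity
    rcases hll k with h | h
    · simp [h]
    · rw [h, mul_one, integral_exp_neg_mul_add_sq_gaussianReal hv ht, Real.exp_add, one_mul,
        Real.exp_log hp, one_mul]
  simp_rw [h2]
  rw [← Real.exp_sum, Finset.sum_add_distrib, ← Finset.sum_mul, hsum, Real.exp_add, hform b,
    Finset.sum_neg_distrib, ← Finset.sum_div, ← Finset.mul_sum, Real.exp_nat_mul,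
    Real.exp_log (by positivity)]

/-- The orthogonal projection onto the orthogonal complement of the row space of `R`
(when the rows of `R` are linearly independent). -/
noncomputable def rowCompl {n d : ℕ} (R : Matrix (Fin n) (Fin d) ℝ) :
    Matrix (Fin d) (Fin d) ℝ :=
  1 - Rᵀ * (R * Rᵀ)⁻¹ * R

section rowCompl

variable {n d : ℕ} (R : Matrix (Fin n) (Fin d) ℝ)

theorem measurable_rowCompl : Measurable (rowCompl : Matrix (Fin n) (Fin d) ℝ → _) :=
  measurable_const.matrix_sub (((measurable_id.matrix_transpose).matrix_mul
    (measurable_id.matrix_mul measurable_id.matrix_transpose).matrix_inv).matrix_mul measurable_id)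

theorem nonsing_inv_mul_mul_nonsing_inv (K : Matrix (Fin n) (Fin n) ℝ) : K⁻¹ * K * K⁻¹ = K⁻¹ := by
  by_cases h : IsUnit K.det
  · rw [Matrix.nonsing_inv_mul _ h, Matrix.one_mul]
  · rw [Matrix.nonsing_inv_apply_not_isUnit _ h, Matrix.mul_zero]

theorem transpose_rowCompl : (rowCompl R)ᵀ = rowCompl R := by
  simp [rowCompl, Matrix.transpose_sub, Matrix.transpose_mul, Matrix.transpose_nonsing_inv,
    Matrix.mul_assoc]

theorem rowCompl_mul_self : rowCompl R * rowCompl R = rowCompl R := by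
  have h : (Rᵀ * (R * Rᵀ)⁻¹ * R) * (Rᵀ * (R * Rᵀ)⁻¹ * R) = Rᵀ * (R * Rᵀ)⁻¹ * R := by
    calc _ = Rᵀ * ((R * Rᵀ)⁻¹ * (R * Rᵀ) * (R * Rᵀ)⁻¹) * R := by simp only [Matrix.mul_assoc]
      _ = _ := by rw [nonsing_inv_mul_mul_nonsing_inv]
  rw [rowCompl, Matrix.sub_mul, Matrix.mul_sub, Matrix.mul_sub, h]
  simp

theorem rowCompl_mul_orthogonal {O : Matrix (Fin d) (Fin d) ℝ}
    (hO : O ∈ Matrix.orthogonalGroup (Fin d) ℝ) : rowCompl (R * O) = Oᵀ * rowCompl R * O := by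
  have hO1 : O * Oᵀ = 1 := by
    have := (Matrix.mem_orthogonalGroup_iff (Fin d) ℝ).1 hO
    simpa [Matrix.star_eq_conjTranspose] using this
  have hO2 : Oᵀ * O = 1 := by
    have := (Matrix.mem_orthogonalGroup_iff' (Fin d) ℝ).1 hO
    simpa [Matrix.star_eq_conjTranspose] using this
  have h : R * O * (R * O)ᵀ = R * Rᵀ := by
    rw [Matrix.transpose_mul]
    calc _ = R * (O * Oᵀ) * Rᵀ := by simp only [Matrix.mul_assoc]
      _ = _ := by rw [hO1, Matrix.mul_one]
  rw [rowCompl, h, rowCompl, Matrix.mul_sub, Matrix.sub_mul, Matrix.mul_one, hO2,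
    Matrix.transpose_mul]
  simp only [Matrix.mul_assoc]

theorem dotProduct_rowCompl_eq (y : Fin d → ℝ) :
    y ⬝ᵥ rowCompl R *ᵥ y = (rowCompl R *ᵥ y) ⬝ᵥ (rowCompl R *ᵥ y) := by
  conv_lhs => rw [← rowCompl_mul_self, ← Matrix.mulVec_mulVec, Matrix.dotProduct_mulVec,
    ← Matrix.mulVec_transpose, transpose_rowCompl]

theorem dotProduct_rowCompl_nonneg (y : Fin d → ℝ) : 0 ≤ y ⬝ᵥ rowCompl R *ᵥ y := by
  rw [dotProduct_rowCompl_eq]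
  exact Finset.sum_nonneg fun k _ => mul_self_nonneg _

theorem dotProduct_rowCompl_le (y : Fin d → ℝ) : y ⬝ᵥ rowCompl R *ᵥ y ≤ y ⬝ᵥ y := by
  have h : 0 ≤ (y - rowCompl R *ᵥ y) ⬝ᵥ (y - rowCompl R *ᵥ y) :=
    Finset.sum_nonneg fun k _ => mul_self_nonneg _
  rw [sub_dotProduct, dotProduct_sub, dotProduct_sub, ← dotProduct_rowCompl_eq,
    dotProduct_comm (rowCompl R *ᵥ y) y] at h
  linarith

theorem rowCompl_apply_eq (k l : Fin d) :
    rowCompl R k l = ∑ j, rowCompl R k j * rowCompl R l j := by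
  conv_lhs => rw [← rowCompl_mul_self, Matrix.mul_apply]
  refine Finset.sum_congr rfl fun j _ => ?_
  congr 1
  conv_lhs => rw [← transpose_rowCompl, Matrix.transpose_apply]

theorem rowCompl_apply_symm (k l : Fin d) : rowCompl R k l = rowCompl R l k := by
  conv_lhs => rw [← transpose_rowCompl, Matrix.transpose_apply]

theorem rowCompl_apply_eq_form (k l : Fin d) :
    rowCompl R k l = Pi.single k 1 ⬝ᵥ rowCompl R *ᵥ Pi.single l 1 := by
  simp

theorem rowCompl_diag_nonneg (k : Fin d) : 0 ≤ rowCompl R k k := by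
  rw [rowCompl_apply_eq_form]; exact dotProduct_rowCompl_nonneg R _

theorem rowCompl_diag_le_one (k : Fin d) : rowCompl R k k ≤ 1 := by
  rw [rowCompl_apply_eq_form]
  refine (dotProduct_rowCompl_le R _).trans ?_
  simp

variable {R}

theorem mul_rowCompl (h : IsUnit (R * Rᵀ).det) : R * rowCompl R = 0 := by
  rw [rowCompl, Matrix.mul_sub, ← Matrix.mul_assoc, ← Matrix.mul_assoc, Matrix.mul_nonsing_inv _ h,
    Matrix.mul_one, Matrix.one_mul, sub_self]

theorem trace_rowCompl (h : IsUnit (R * Rᵀ).det) : (rowCompl R).trace = d - n := by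
  rw [rowCompl, Matrix.trace_sub, Matrix.trace_mul_comm, ← Matrix.mul_assoc,
    Matrix.mul_nonsing_inv _ h]
  simp

theorem vecMul_succAbove (B : Matrix (Fin (n + 1)) (Fin d) ℝ) (i : Fin (n + 1))
    (x : Fin (n + 1) → ℝ) :
    x ᵥ* B = x i • B i + (fun l => x (i.succAbove l)) ᵥ* (B.submatrix i.succAbove id) := by
  ext k
  simp [Matrix.vecMul, dotProduct, Fin.sum_univ_succAbove _ i]

theorem gram_inv_diag (B : Matrix (Fin (n + 1)) (Fin d) ℝ) (i : Fin (n + 1))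
    (h : IsUnit (B.submatrix i.succAbove id * (B.submatrix i.succAbove id)ᵀ).det)
    (hZ : B i ⬝ᵥ rowCompl (B.submatrix i.succAbove id) *ᵥ B i ≠ 0) :
    IsUnit (B * Bᵀ).det ∧
      (B * Bᵀ)⁻¹ i i = (B i ⬝ᵥ rowCompl (B.submatrix i.succAbove id) *ᵥ B i)⁻¹ := by
  set C := B.submatrix i.succAbove id with hC
  set b := B i with hb
  have hCQ : C *ᵥ (rowCompl C *ᵥ b) = 0 := by
    rw [Matrix.mulVec_mulVec, mul_rowCompl h, Matrix.zero_mulVec]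
  have hU : IsUnit (B * Bᵀ).det := by
    rw [isUnit_iff_ne_zero]
    intro h0
    obtain ⟨y, hy, hy0⟩ := Matrix.exists_mulVec_eq_zero_iff.2 h0
    have h1 : y ᵥ* B = 0 := by
      have : (y ᵥ* B) ⬝ᵥ (y ᵥ* B) = 0 := by
        rw [← Matrix.dotProduct_mulVec, ← Matrix.mulVec_transpose, Matrix.mulVec_mulVec, hy0,
          dotProduct_zero]
      exact dotProduct_self_eq_zero.1 this
    have h2 := vecMul_succAbove B i y
    rw [h1, ← hC, ← hb] at h2
    have hyi : y i = 0 := by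
      have h3 : (0 : Fin d → ℝ) ⬝ᵥ (rowCompl C *ᵥ b) = y i * (b ⬝ᵥ rowCompl C *ᵥ b) := by
        rw [h2, add_dotProduct, smul_dotProduct, ← Matrix.dotProduct_mulVec, hCQ, dotProduct_zero,
          add_zero, smul_eq_mul]
      rw [zero_dotProduct] at h3
      exact (mul_eq_zero.1 h3.symm).resolve_right hZ
    rw [hyi, zero_smul, zero_add] at h2
    have h4 : (fun l => y (i.succAbove l)) = 0 := by
      have : (fun l => y (i.succAbove l)) ᵥ* (C * Cᵀ) = 0 := by
        rw [← Matrix.vecMul_vecMul, ← h2, Matrix.zero_vecMul]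
      have h5 := congrArg (fun w => w ᵥ* (C * Cᵀ)⁻¹) this
      simpa [Matrix.vecMul_vecMul, Matrix.mul_nonsing_inv _ h] using h5
    apply hy
    ext k
    rcases Fin.eq_self_or_eq_succAbove i k with rfl | ⟨l, rfl⟩
    · exact hyi
    · exact congrFun h4 l
  refine ⟨hU, ?_⟩
  set x : Fin (n + 1) → ℝ := i.insertNth (α := fun _ => ℝ) 1 (-((C * Cᵀ)⁻¹ *ᵥ (C *ᵥ b))) with hx
  have hxB : x ᵥ* B = rowCompl C *ᵥ b := by
    rw [vecMul_succAbove B i x, ← hC, ← hb]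
    have h1 : x i = 1 := by simp [hx]
    have h2 : (fun l => x (i.succAbove l)) = -((C * Cᵀ)⁻¹ *ᵥ (C *ᵥ b)) := by
      ext l; simp [hx]
    rw [h1, h2, one_smul, Matrix.neg_vecMul, ← Matrix.mulVec_transpose, Matrix.mulVec_mulVec,
      Matrix.mulVec_mulVec, rowCompl, Matrix.sub_mulVec, Matrix.one_mulVec, sub_eq_add_neg,
      Matrix.mul_assoc]
  have hGx : (B * Bᵀ) *ᵥ x = Pi.single i (b ⬝ᵥ rowCompl C *ᵥ b) := by
    rw [← Matrix.mulVec_mulVec, Matrix.mulVec_transpose, hxB]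
    ext k
    rcases Fin.eq_self_or_eq_succAbove i k with rfl | ⟨l, rfl⟩
    · simp [Matrix.mulVec, ← hb]
    · have := congrFun hCQ l
      simpa [Matrix.mulVec, hC] using this
  have hx2 : x = (B * Bᵀ)⁻¹ *ᵥ Pi.single i (b ⬝ᵥ rowCompl C *ᵥ b) := by
    rw [← hGx, Matrix.mulVec_mulVec, Matrix.nonsing_inv_mul _ hU, Matrix.one_mulVec]
  have h6 := congrFun hx2 i
  have h1 : x i = 1 := by simp [hx]
  rw [h1] at h6
  simp only [Matrix.mulVec_single, Matrix.col_apply, Pi.smul_apply, MulOpposite.smul_eq_mul_unop,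
    MulOpposite.unop_op] at h6
  exact eq_inv_of_mul_eq_one_left h6.symm

end rowCompl

theorem measurePreserving_splitRow_gaussMatrix (n d : ℕ) (v : NNReal) (i : Fin (n + 1)) :
    MeasurePreserving
      (fun A : Matrix (Fin (n + 1)) (Fin d) ℝ => (A.submatrix i.succAbove id, A i))
      (gaussMatrix (n + 1) d v)
      ((gaussMatrix n d v).prod (Measure.pi fun _ : Fin d => gaussianReal 0 v)) := by
  have h1 := measurePreserving_piFinSuccAbove
    (fun _ : Fin (n + 1) => Measure.pi fun _ : Fin d => gaussianReal 0 v) i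
  exact (Measure.measurePreserving_swap (μ := Measure.pi fun _ : Fin d => gaussianReal 0 v)
    (ν := Measure.pi fun _ : Fin n => Measure.pi fun _ : Fin d => gaussianReal 0 v)).comp h1

theorem measurable_form_rowCompl {n d : ℕ} (M : Matrix (Fin n) (Fin d) ℝ) (b : Fin d → ℝ) :
    Measurable fun p : Matrix (Fin n) (Fin d) ℝ × (Fin d → ℝ) =>
      (b + p.2) ⬝ᵥ rowCompl (M + p.1) *ᵥ (b + p.2) := by
  have hQ : Measurable fun p : Matrix (Fin n) (Fin d) ℝ × (Fin d → ℝ) => rowCompl (M + p.1) :=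
    measurable_rowCompl.comp (measurable_const.matrix_add measurable_fst)
  have hb : ∀ k, Measurable fun p : Matrix (Fin n) (Fin d) ℝ × (Fin d → ℝ) => (b + p.2) k :=
    fun k => measurable_const.add ((measurable_pi_apply k).comp measurable_snd)
  simp only [dotProduct, Matrix.mulVec]
  exact Finset.measurable_sum _ fun k _ => (hb k).mul
    (Finset.measurable_sum _ fun l _ => (hQ.matrix_entry k l).mul (hb l))

section

variable {n d : ℕ} {v : NNReal}

theorem integral_exp_neg_form_rowCompl (hv : v ≠ 0) {R : Matrix (Fin n) (Fin d) ℝ}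
    (hR : IsUnit (R * Rᵀ).det) (hnd : n ≤ d) (b : Fin d → ℝ) {t : ℝ} (ht : 0 ≤ t) :
    ∫ x, Real.exp (-(t * ((b + x) ⬝ᵥ rowCompl R *ᵥ (b + x))))
        ∂(Measure.pi fun _ : Fin d => gaussianReal 0 v) =
      (√(1 + 2 * t * v))⁻¹ ^ (d - n) *
        Real.exp (-(t * (b ⬝ᵥ rowCompl R *ᵥ b) / (1 + 2 * t * v))) :=
  integral_exp_neg_projection_form hv ht (transpose_rowCompl R) (rowCompl_mul_self R)
    (by rw [trace_rowCompl hR, Nat.cast_sub hnd]) b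

theorem integrable_exp_neg_form_rowCompl (R : Matrix (Fin n) (Fin d) ℝ) (b : Fin d → ℝ) {t : ℝ}
    (ht : 0 ≤ t) :
    Integrable (fun x => Real.exp (-(t * ((b + x) ⬝ᵥ rowCompl R *ᵥ (b + x)))))
      (Measure.pi fun _ : Fin d => gaussianReal 0 v) := by
  refine Integrable.of_bound (C := 1) (by fun_prop) (ae_of_all _ fun x => ?_)
  rw [Real.norm_eq_abs, Real.abs_exp, Real.exp_le_one_iff]
  have := mul_nonneg ht (dotProduct_rowCompl_nonneg R (b + x))
  linarith

theorem ae_form_rowCompl_ne_zero (hv : v ≠ 0) {R : Matrix (Fin n) (Fin d) ℝ}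
    (hR : IsUnit (R * Rᵀ).det) (hnd : n < d) (b : Fin d → ℝ) :
    ∀ᵐ x ∂(Measure.pi fun _ : Fin d => gaussianReal 0 v),
      (b + x) ⬝ᵥ rowCompl R *ᵥ (b + x) ≠ 0 := by
  set μ := Measure.pi fun _ : Fin d => gaussianReal 0 v
  have hv0 : (0 : ℝ) < v := by positivity
  set s : Set (Fin d → ℝ) := {x | (b + x) ⬝ᵥ rowCompl R *ᵥ (b + x) = 0}
  have hs : MeasurableSet s := by
    refine measurableSet_eq_fun (by fun_prop) (by fun_prop)
  have hle : ∀ t : ℝ, 0 ≤ t → μ.real s ≤ (√(1 + 2 * t * v))⁻¹ ^ (d - n) := by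
    intro t ht
    rw [← integral_indicator_one hs]
    calc ∫ x, s.indicator 1 x ∂μ
        ≤ ∫ x, Real.exp (-(t * ((b + x) ⬝ᵥ rowCompl R *ᵥ (b + x)))) ∂μ := by
          refine integral_mono ((integrable_const (1 : ℝ)).indicator hs)
            (integrable_exp_neg_form_rowCompl R b ht) fun x => ?_
          by_cases hx : x ∈ s
          · have : (b + x) ⬝ᵥ rowCompl R *ᵥ (b + x) = 0 := hx
            simp [hx, this]
          · simp only [Set.indicator_of_notMem hx]; positivity
      _ ≤ _ := by
          rw [integral_exp_neg_form_rowCompl hv hR hnd.le b ht]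
          refine mul_le_of_le_one_right (by positivity) (Real.exp_le_one_iff.2 ?_)
          have := dotProduct_rowCompl_nonneg R b
          have : 0 ≤ t * (b ⬝ᵥ rowCompl R *ᵥ b) / (1 + 2 * t * v) := by positivity
          linarith
  have hlim : Tendsto (fun t : ℝ => (√(1 + 2 * t * v))⁻¹ ^ (d - n)) atTop (nhds 0) := by
    have h1 : Tendsto (fun t : ℝ => (√(1 + 2 * t * v))⁻¹) atTop (nhds 0) := by
      refine tendsto_inv_atTop_zero.comp (Real.tendsto_sqrt_atTop.comp ?_)
      refine tendsto_atTop_add_const_left _ _ ?_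
      exact (tendsto_id.const_mul_atTop two_pos).atTop_mul_const hv0
    have := h1.pow (d - n)
    rwa [zero_pow (by omega)] at this
  have h0 : μ.real s = 0 := le_antisymm
    (ge_of_tendsto hlim ((eventually_ge_atTop 0).mono hle)) measureReal_nonneg
  rw [measureReal_eq_zero_iff] at h0
  exact measure_eq_zero_iff_ae_notMem.1 h0

theorem ae_isUnit_det_gram_and_form_ne_zero (hv : v ≠ 0) (hnd : n < d)
    (M : Matrix (Fin (n + 1)) (Fin d) ℝ) (i : Fin (n + 1))
    (h : ∀ᵐ C ∂(gaussMatrix n d v), IsUnit ((M.submatrix i.succAbove id + C) *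
      (M.submatrix i.succAbove id + C)ᵀ).det) :
    ∀ᵐ A ∂(gaussMatrix (n + 1) d v),
      IsUnit (((M + A).submatrix i.succAbove id) * ((M + A).submatrix i.succAbove id)ᵀ).det ∧
      (M + A) i ⬝ᵥ rowCompl ((M + A).submatrix i.succAbove id) *ᵥ (M + A) i ≠ 0 := by
  set M' := M.submatrix i.succAbove id
  have h2 : ∀ᵐ p ∂((gaussMatrix n d v).prod (Measure.pi fun _ : Fin d => gaussianReal 0 v)),
      IsUnit ((M' + p.1) * (M' + p.1)ᵀ).det ∧
      (M i + p.2) ⬝ᵥ rowCompl (M' + p.1) *ᵥ (M i + p.2) ≠ 0 := by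
    have hm1 : Measurable fun p : Matrix (Fin n) (Fin d) ℝ × (Fin d → ℝ) =>
        M' + p.1 := measurable_const.matrix_add measurable_fst
    have hm := measurable_form_rowCompl M' (M i)
    rw [Measure.ae_prod_iff_ae_ae]
    · filter_upwards [h] with C hC
      filter_upwards [ae_form_rowCompl_ne_zero hv hC hnd (M i)] with x hx
      exact ⟨hC, hx⟩
    · simp only [isUnit_iff_ne_zero]
      have hd := (hm1.matrix_mul hm1.matrix_transpose).matrix_det
      exact (measurableSet_eq_fun hd measurable_const).compl.inter
        (measurableSet_eq_fun hm measurable_const).compl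
  exact (measurePreserving_splitRow_gaussMatrix n d v i).quasiMeasurePreserving.ae h2

theorem ae_isUnit_det_gram (hv : v ≠ 0) (hnd : n ≤ d) (M : Matrix (Fin n) (Fin d) ℝ) :
    ∀ᵐ A ∂(gaussMatrix n d v), IsUnit ((M + A) * (M + A)ᵀ).det := by
  induction n with
  | zero => exact ae_of_all _ fun A => by simp
  | succ n ih =>
    filter_upwards [ae_isUnit_det_gram_and_form_ne_zero hv (by omega) M 0 (ih (by omega) _)]
      with A hA
    exact (gram_inv_diag (M + A) 0 hA.1 hA.2).1

theorem ofReal_inv_eq_lintegral_exp {z : ℝ} (hz : 0 < z) :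
    ENNReal.ofReal z⁻¹ = ∫⁻ t in Set.Ioi (0 : ℝ), ENNReal.ofReal (Real.exp (-(t * z))) := by
  have h1 : ∫ t in Set.Ioi (0 : ℝ), Real.exp (-(t * z)) = z⁻¹ := by
    have := integral_exp_mul_Ioi (a := -z) (by linarith) 0
    simp only [mul_zero, Real.exp_zero] at this
    rw [← neg_div_neg_eq, neg_neg, neg_neg, one_div] at this
    rw [← this]
    refine integral_congr_ae (ae_of_all _ fun t => ?_)
    ring_nf
  rw [← h1, ofReal_integral_eq_lintegral_ofReal]
  · have := integrableOn_exp_mul_Ioi (a := -z) (by linarith) 0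
    refine this.congr (ae_of_all _ fun t => ?_)
    ring_nf
  · exact ae_of_all _ fun t => (Real.exp_pos _).le

theorem lintegral_inv_form_rowCompl (hv : v ≠ 0) {R : Matrix (Fin n) (Fin d) ℝ}
    (hR : IsUnit (R * Rᵀ).det) (hnd : n < d) (b : Fin d → ℝ) :
    ∫⁻ x, ENNReal.ofReal ((b + x) ⬝ᵥ rowCompl R *ᵥ (b + x))⁻¹
        ∂(Measure.pi fun _ : Fin d => gaussianReal 0 v) =
      ∫⁻ t in Set.Ioi (0 : ℝ), ENNReal.ofReal ((√(1 + 2 * t * v))⁻¹ ^ (d - n) *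
        Real.exp (-(t * (b ⬝ᵥ rowCompl R *ᵥ b) / (1 + 2 * t * v)))) := by
  have h1 : ∫⁻ x, ENNReal.ofReal ((b + x) ⬝ᵥ rowCompl R *ᵥ (b + x))⁻¹
        ∂(Measure.pi fun _ : Fin d => gaussianReal 0 v) =
      ∫⁻ x, (∫⁻ t in Set.Ioi (0 : ℝ), ENNReal.ofReal (Real.exp
        (-(t * ((b + x) ⬝ᵥ rowCompl R *ᵥ (b + x))))))
        ∂(Measure.pi fun _ : Fin d => gaussianReal 0 v) := by
    refine lintegral_congr_ae ?_
    filter_upwards [ae_form_rowCompl_ne_zero hv hR hnd b] with x hx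
    exact ofReal_inv_eq_lintegral_exp
      (lt_of_le_of_ne (dotProduct_rowCompl_nonneg R (b + x)) (Ne.symm hx))
  rw [h1, lintegral_lintegral_swap]
  · refine setLIntegral_congr_fun measurableSet_Ioi fun t ht => ?_
    have ht0 : 0 ≤ t := le_of_lt ht
    rw [← integral_exp_neg_form_rowCompl hv hR hnd.le b ht0, ofReal_integral_eq_lintegral_ofReal
      (integrable_exp_neg_form_rowCompl R b ht0) (ae_of_all _ fun t => (Real.exp_pos _).le)]
  · refine Measurable.aemeasurable ?_
    unfold Function.uncurry
    fun_prop

theorem lintegral_gram_inv_diag (hv : v ≠ 0) (hnd : n < d) (M : Matrix (Fin (n + 1)) (Fin d) ℝ)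
    (i : Fin (n + 1)) :
    ∫⁻ A, ENNReal.ofReal (((M + A) * (M + A)ᵀ)⁻¹ i i) ∂(gaussMatrix (n + 1) d v) =
      ∫⁻ t in Set.Ioi (0 : ℝ), ∫⁻ C, ENNReal.ofReal ((√(1 + 2 * t * v))⁻¹ ^ (d - n) *
        Real.exp (-(t * (M i ⬝ᵥ rowCompl (M.submatrix i.succAbove id + C) *ᵥ M i) /
          (1 + 2 * t * v)))) ∂(gaussMatrix n d v) := by
  set M' := M.submatrix i.succAbove id
  have hm := measurable_form_rowCompl M' (M i)
  have hu := ae_isUnit_det_gram hv hnd.le M'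
  have hm2 : Measurable fun C => M i ⬝ᵥ rowCompl (M' + C) *ᵥ M i := by
    have := hm.comp (measurable_id.prodMk (measurable_const (a := (0 : Fin d → ℝ))))
    simpa [Function.comp_def] using this
  have h1 : ∫⁻ A, ENNReal.ofReal (((M + A) * (M + A)ᵀ)⁻¹ i i) ∂(gaussMatrix (n + 1) d v) =
      ∫⁻ A, ENNReal.ofReal ((M i + A i) ⬝ᵥ rowCompl (M' + A.submatrix i.succAbove id) *ᵥ
        (M i + A i))⁻¹ ∂(gaussMatrix (n + 1) d v) := by
    refine lintegral_congr_ae ?_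
    filter_upwards [ae_isUnit_det_gram_and_form_ne_zero hv hnd M i hu] with A hA
    rw [(gram_inv_diag (M + A) i hA.1 hA.2).2]
    rfl
  have hmi : Measurable fun p : Matrix (Fin n) (Fin d) ℝ × (Fin d → ℝ) =>
      ENNReal.ofReal ((M i + p.2) ⬝ᵥ rowCompl (M' + p.1) *ᵥ (M i + p.2))⁻¹ :=
    hm.inv.ennreal_ofReal
  rw [h1, (measurePreserving_splitRow_gaussMatrix n d v i).lintegral_comp hmi,
    lintegral_prod _ hmi.aemeasurable]
  symm
  rw [lintegral_lintegral_swap]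
  · refine lintegral_congr_ae ?_
    filter_upwards [hu] with C hC
    exact Eq.symm <| lintegral_inv_form_rowCompl hv hC hnd (M i)
  · refine Measurable.aemeasurable ?_
    have hm3 : Measurable fun p : ℝ × Matrix (Fin n) (Fin d) ℝ =>
        M i ⬝ᵥ rowCompl (M' + p.2) *ᵥ M i := hm2.comp measurable_snd
    have hm4 : Measurable fun p : ℝ × Matrix (Fin n) (Fin d) ℝ => p.1 := measurable_fst
    unfold Function.uncurry
    exact ((((hm4.const_mul 2).mul_const _).const_add 1).sqrt.inv.pow_const _ |>.mul
      ((hm4.mul hm3).div (((hm4.const_mul 2).mul_const _).const_add 1)).neg.exp).ennreal_ofReal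

end

theorem exists_orthogonal_mulVec_single {d n : ℕ} (M : Matrix (Fin n) (Fin d) ℝ) (i : Fin d)
    (h : Fin d → ℝ) (hh : h ⬝ᵥ h = 1) (hMi : M *ᵥ Pi.single i 1 = 0) (hMh : M *ᵥ h = 0) :
    ∃ O ∈ Matrix.orthogonalGroup (Fin d) ℝ, O *ᵥ Pi.single i 1 = h ∧ M * O = M := by
  set w : Fin d → ℝ := Pi.single i 1 - h with hw
  set s := w ⬝ᵥ w with hs
  have hs2 : s = 2 * (1 - h i) := by
    rw [hs, hw, sub_dotProduct, dotProduct_sub, dotProduct_sub, hh]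
    simp
    ring
  set O : Matrix (Fin d) (Fin d) ℝ := 1 - (2 / s) • vecMulVec w w with hO
  have hMw : M *ᵥ w = 0 := by rw [hw, Matrix.mulVec_sub, hMi, hMh, sub_zero]
  have hOt : Oᵀ = O := by
    rw [hO, Matrix.transpose_sub, Matrix.transpose_smul, Matrix.transpose_vecMulVec,
      Matrix.transpose_one]
  by_cases hs0 : s = 0
  · have hw0 : w = 0 := dotProduct_self_eq_zero.1 hs0
    refine ⟨1, one_mem _, ?_, Matrix.mul_one _⟩
    rw [Matrix.one_mulVec, ← sub_eq_zero]
    exact hw0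
  refine ⟨O, ?_, ?_, ?_⟩
  · rw [Matrix.mem_orthogonalGroup_iff, hOt, hO, Matrix.sub_mul, Matrix.mul_sub,
      Matrix.mul_sub, Matrix.smul_mul, Matrix.mul_smul, Matrix.mul_smul, Matrix.smul_mul,
      Matrix.vecMulVec_mul_vecMulVec, ← hs]
    ext k l
    simp [Matrix.vecMulVec_apply]
    field_simp
    ring
  · rw [hO, Matrix.sub_mulVec, Matrix.one_mulVec, Matrix.smul_mulVec, Matrix.vecMulVec_mulVec]
    have h1 : w ⬝ᵥ Pi.single i 1 = s / 2 := by rw [hs2, hw]; simp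
    ext k
    simp only [h1, Pi.sub_apply, Pi.smul_apply, MulOpposite.smul_eq_mul_unop, smul_eq_mul,
      MulOpposite.unop_op]
    have h2 : 2 / s * (w k * (s / 2)) = w k := by field_simp
    rw [h2, hw]
    simp
  · rw [hO, Matrix.mul_sub, Matrix.mul_one, Matrix.mul_smul, Matrix.mul_vecMulVec, hMw]
    simp

theorem apply_eq_single_dotProduct_mulVec_single {d : ℕ} (K : Matrix (Fin d) (Fin d) ℝ)
    (k l : Fin d) : K k l = Pi.single k 1 ⬝ᵥ K *ᵥ Pi.single l 1 := by
  simp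

theorem integral_sub_const_sq {Ω : Type*} [MeasurableSpace Ω] {μ : Measure Ω}
    [IsProbabilityMeasure μ] {f : Ω → ℝ} (hf : Integrable f μ)
    (hf2 : Integrable (fun ω => f ω ^ 2) μ) (a : ℝ) :
    Integrable (fun ω => (f ω - a) ^ 2) μ ∧
      ∫ ω, (f ω - a) ^ 2 ∂μ = (∫ ω, f ω ^ 2 ∂μ) - 2 * a * (∫ ω, f ω ∂μ) + a ^ 2 := by
  have he : (fun ω => (f ω - a) ^ 2) = fun ω => f ω ^ 2 - 2 * a * f ω + a ^ 2 := by
    ext ω; ring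
  have h1 : Integrable (fun ω => 2 * a * f ω) μ := hf.const_mul _
  have h2 : Integrable (fun ω => f ω ^ 2 - 2 * a * f ω) μ := hf2.sub h1
  rw [he]
  refine ⟨h2.add (integrable_const _), ?_⟩
  rw [integral_add h2 (integrable_const _), integral_sub hf2 h1, integral_const_mul]
  simp

theorem integral_sq_add_sq {Ω : Type*} [MeasurableSpace Ω] {μ : Measure Ω} {x y z : Ω → ℝ}
    (hx : Integrable (fun ω => x ω ^ 2) μ) (hy : Integrable (fun ω => y ω ^ 2) μ)
    (hz : Integrable (fun ω => z ω ^ 2) μ) (hxy : Integrable (fun ω => x ω * y ω) μ) :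
    ∫ ω, (((x ω + y ω) / 2 + 1 * z ω) ^ 2 + ((x ω + y ω) / 2 + (-1) * z ω) ^ 2) ∂μ =
      (∫ ω, (x ω * y ω + 2 * z ω ^ 2) ∂μ) +
        (1 / 2) * ((∫ ω, x ω ^ 2 ∂μ) + ∫ ω, y ω ^ 2 ∂μ) := by
  have h1 : Integrable (fun ω => x ω * y ω + 2 * z ω ^ 2) μ := hxy.add (hz.const_mul 2)
  have h2 : Integrable (fun ω => 1 / 2 * (x ω ^ 2 + y ω ^ 2)) μ := (hx.add hy).const_mul _
  rw [← integral_add hx hy, ← integral_const_mul, ← integral_add h1 h2]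
  congr 1
  ext ω
  ring

section

variable {n d : ℕ} (v : NNReal) (M : Matrix (Fin n) (Fin d) ℝ)

theorem measurable_rowCompl_add_apply (k l : Fin d) :
    Measurable fun C : Matrix (Fin n) (Fin d) ℝ => rowCompl (M + C) k l :=
  (measurable_rowCompl.comp (measurable_const.matrix_add measurable_id)).matrix_entry k l

theorem integral_comp_rowCompl_form {f : ℝ → ℝ} (hf : Measurable f) (i : Fin d) (h : Fin d → ℝ)
    (hh : h ⬝ᵥ h = 1) (hMi : M *ᵥ Pi.single i 1 = 0) (hMh : M *ᵥ h = 0) :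
    ∫ C, f (h ⬝ᵥ rowCompl (M + C) *ᵥ h) ∂(gaussMatrix n d v) =
      ∫ C, f (rowCompl (M + C) i i) ∂(gaussMatrix n d v) := by
  obtain ⟨O, hO, hOi, hMO⟩ := exists_orthogonal_mulVec_single M i h hh hMi hMh
  have hm : Measurable fun C : Matrix (Fin n) (Fin d) ℝ => C * O :=
    measurable_id.matrix_mul measurable_const
  have hg : Measurable fun C : Matrix (Fin n) (Fin d) ℝ => f (rowCompl (M + C) i i) :=
    hf.comp (measurable_rowCompl_add_apply M i i)
  have hmap := integral_map (μ := gaussMatrix n d v) hm.aemeasurable hg.aestronglyMeasurable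
  rw [map_mul_right_gaussMatrix v O hO] at hmap
  refine Eq.trans ?_ hmap.symm
  refine integral_congr_ae (ae_of_all _ fun C => ?_)
  have h1 : M + C * O = (M + C) * O := by rw [Matrix.add_mul, hMO]
  simp only
  congr 1
  rw [h1, rowCompl_mul_orthogonal _ hO, 
    apply_eq_single_dotProduct_mulVec_single (Oᵀ * rowCompl (M + C) * O) i i, ← hOi]
  simp only [← Matrix.mulVec_mulVec]
  rw [Matrix.dotProduct_mulVec (Pi.single i 1), Matrix.vecMul_transpose]

theorem rowCompl_apply_sq_le_one (R : Matrix (Fin n) (Fin d) ℝ) (k l : Fin d) :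
    rowCompl R k l ^ 2 ≤ 1 := by
  refine le_trans ?_ (rowCompl_diag_le_one R k)
  rw [rowCompl_apply_eq R k k]
  simp_rw [← pow_two]
  exact Finset.single_le_sum (f := fun j => rowCompl R k j ^ 2) (fun _ _ => sq_nonneg _)
    (Finset.mem_univ l)

theorem integrable_rowCompl_mul (k l k' l' : Fin d) :
    Integrable (fun C => rowCompl (M + C) k l * rowCompl (M + C) k' l')
      (gaussMatrix n d v) := by
  refine Integrable.of_bound (C := 1) ((measurable_rowCompl_add_apply M k l).mul
    (measurable_rowCompl_add_apply M k' l')).aestronglyMeasurable (ae_of_all _ fun C => ?_)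
  have h1 := rowCompl_apply_sq_le_one (M + C) k l
  have h2 := rowCompl_apply_sq_le_one (M + C) k' l'
  rw [Real.norm_eq_abs, abs_le]
  constructor <;> nlinarith [sq_nonneg (rowCompl (M + C) k l - rowCompl (M + C) k' l'),
    sq_nonneg (rowCompl (M + C) k l + rowCompl (M + C) k' l')]

theorem integrable_rowCompl (k l : Fin d) :
    Integrable (fun C => rowCompl (M + C) k l) (gaussMatrix n d v) := by
  refine Integrable.of_bound (C := 1)
    (measurable_rowCompl_add_apply M k l).aestronglyMeasurable (ae_of_all _ fun C => ?_)
  have h1 := rowCompl_apply_sq_le_one (M + C) k l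
  rw [Real.norm_eq_abs, ← sq_le_one_iff_abs_le_one]
  exact h1

theorem mulVec_single_eq_zero_of_col_eq_zero {M : Matrix (Fin n) (Fin d) ℝ} {k : Fin d}
    (hk : ∀ l, M l k = 0) : M *ᵥ Pi.single k 1 = 0 := by
  ext l; simp [hk l]

theorem integral_rowCompl_diag_eq {f : ℝ → ℝ} (hf : Measurable f) {i k : Fin d}
    (hi : ∀ l, M l i = 0) (hk : ∀ l, M l k = 0) :
    ∫ C, f (rowCompl (M + C) k k) ∂(gaussMatrix n d v) =
      ∫ C, f (rowCompl (M + C) i i) ∂(gaussMatrix n d v) := by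
  have := integral_comp_rowCompl_form v M hf i (Pi.single k 1) (by simp)
    (mulVec_single_eq_zero_of_col_eq_zero hi) (mulVec_single_eq_zero_of_col_eq_zero hk)
  simp_rw [← rowCompl_apply_eq_form] at this
  exact this

theorem integral_rowCompl_diag_sq_le {i k l : Fin d}
    (hi : ∀ j, M j i = 0) (hk : ∀ j, M j k = 0) (hl : ∀ j, M j l = 0) :
    ∫ C, rowCompl (M + C) i i ^ 2 ∂(gaussMatrix n d v) ≤
      ∫ C, (rowCompl (M + C) k k * rowCompl (M + C) l l + 2 * rowCompl (M + C) k l ^ 2)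
        ∂(gaussMatrix n d v) := by
  have hsq : ∀ a b : Fin d, Integrable (fun C => rowCompl (M + C) a b ^ 2)
      (gaussMatrix n d v) := fun a b => by
    simpa [pow_two] using integrable_rowCompl_mul v M a b a b
  have hkk := integral_rowCompl_diag_eq v M (f := fun x => x ^ 2) (by fun_prop) hi hk
  have hll := integral_rowCompl_diag_eq v M (f := fun x => x ^ 2) (by fun_prop) hi hl
  by_cases hkl : k = l
  · subst hkl
    rw [← hkk]
    refine integral_mono (hsq k k)
      ((integrable_rowCompl_mul v M k k k k).add ((hsq k k).const_mul 2)) fun C => ?_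
    have := sq_nonneg (rowCompl (M + C) k k)
    simp only
    nlinarith
  · have hs : (√2)⁻¹ * (√2)⁻¹ = (1 / 2 : ℝ) := by
      rw [← mul_inv, Real.mul_self_sqrt (by norm_num)]; norm_num
    have hform : ∀ e : ℝ, e * e = 1 → ∫ C, ((rowCompl (M + C) k k + rowCompl (M + C) l l) / 2 +
        e * rowCompl (M + C) k l) ^ 2 ∂(gaussMatrix n d v) =
        ∫ C, rowCompl (M + C) i i ^ 2 ∂(gaussMatrix n d v) := by
      intro e he
      have h1 := integral_comp_rowCompl_form v M (f := fun x => x ^ 2) (by fun_prop) i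
        ((√2)⁻¹ • (Pi.single k 1 + e • Pi.single l 1)) ?_
        (mulVec_single_eq_zero_of_col_eq_zero hi) ?_
      · rw [← h1]
        refine integral_congr_ae (ae_of_all _ fun C => ?_)
        have hsym := rowCompl_apply_symm (M + C) l k
        simp only
        congr 1
        generalize rowCompl (M + C) = K at *
        simp only [smul_dotProduct, Matrix.mulVec_smul, dotProduct_smul, add_dotProduct,
          Matrix.mulVec_add, dotProduct_add, smul_eq_mul,
          ← apply_eq_single_dotProduct_mulVec_single]
        rw [hsym]
        linear_combination (-1 / 2 * K l l) * he -
          (K k k + 2 * e * K k l + e ^ 2 * K l l) * hs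
      · simp only [smul_dotProduct, dotProduct_smul, add_dotProduct, dotProduct_add, smul_eq_mul]
        simp only [dotProduct_single, Pi.single_apply, hkl, Ne.symm hkl, if_true, if_false]
        linear_combination (1 / 2) * he + (1 + e ^ 2) * hs
      · rw [Matrix.mulVec_smul, Matrix.mulVec_add, Matrix.mulVec_smul,
          mulVec_single_eq_zero_of_col_eq_zero hk, mulVec_single_eq_zero_of_col_eq_zero hl]
        simp
    have hp := hform 1 (by norm_num)
    have hn := hform (-1) (by norm_num)
    have hint : ∀ e : ℝ, Integrable (fun C => ((rowCompl (M + C) k k + rowCompl (M + C) l l) / 2 +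
        e * rowCompl (M + C) k l) ^ 2) (gaussMatrix n d v) := by
      intro e
      have : (fun C => ((rowCompl (M + C) k k + rowCompl (M + C) l l) / 2 +
          e * rowCompl (M + C) k l) ^ 2) = fun C =>
          (1 / 4) * (rowCompl (M + C) k k * rowCompl (M + C) k k) +
          (1 / 4) * (rowCompl (M + C) l l * rowCompl (M + C) l l) +
          (1 / 2) * (rowCompl (M + C) k k * rowCompl (M + C) l l) +
          e * (rowCompl (M + C) k k * rowCompl (M + C) k l) +
          e * (rowCompl (M + C) l l * rowCompl (M + C) k l) +
          e ^ 2 * (rowCompl (M + C) k l * rowCompl (M + C) k l) := by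
        ext C; ring
      rw [this]
      have hI := integrable_rowCompl_mul v M
      exact (((((hI _ _ _ _).const_mul _).add ((hI _ _ _ _).const_mul _)).add
        ((hI _ _ _ _).const_mul _)).add ((hI _ _ _ _).const_mul _)).add
        ((hI _ _ _ _).const_mul _) |>.add ((hI _ _ _ _).const_mul _)
    have hsum := integral_add (hint 1) (hint (-1))
    rw [hp, hn] at hsum
    have hexp : ∫ C, (((rowCompl (M + C) k k + rowCompl (M + C) l l) / 2 +
        1 * rowCompl (M + C) k l) ^ 2 + ((rowCompl (M + C) k k + rowCompl (M + C) l l) / 2 +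
        (-1) * rowCompl (M + C) k l) ^ 2) ∂(gaussMatrix n d v) =
        (∫ C, (rowCompl (M + C) k k * rowCompl (M + C) l l + 2 * rowCompl (M + C) k l ^ 2)
          ∂(gaussMatrix n d v)) +
        (1 / 2) * ((∫ C, rowCompl (M + C) k k ^ 2 ∂(gaussMatrix n d v)) +
          ∫ C, rowCompl (M + C) l l ^ 2 ∂(gaussMatrix n d v)) :=
      integral_sq_add_sq (hsq k k) (hsq l l) (hsq k l) (integrable_rowCompl_mul v M k k l l)
    rw [hexp, hkk, hll] at hsum
    linarith

theorem integral_rowCompl_diag_sub_sq_le {v : NNReal} (hv : v ≠ 0) (hnd : n ≤ d)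
    (I : Finset (Fin d)) (hI : ∀ k ∈ I, ∀ j, M j k = 0) {i : Fin d} (hi : i ∈ I) {r : ℕ}
    (hr : Iᶜ.card ≤ r) :
    (I.card : ℝ) ^ 2 * ∫ C, (rowCompl (M + C) i i - ((d : ℝ) - n) / d) ^ 2 ∂(gaussMatrix n d v) ≤
      (r : ℝ) ^ 2 + 2 * d := by
  set D : ℝ := ((I.card : ℕ) : ℝ) with hD
  set τ : ℝ := ((d : ℝ) - n) / d with hτ
  have hd0 : (0 : ℝ) < d := by
    have : 0 < d := Fin.pos i
    exact_mod_cast this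
  have hnd' : (n : ℝ) ≤ d := by exact_mod_cast hnd
  set μ := gaussMatrix n d v
  have hsq : ∀ a b : Fin d, Integrable (fun C => rowCompl (M + C) a b ^ 2) μ := fun a b => by
    simpa [pow_two] using integrable_rowCompl_mul v M a b a b
  set T : Matrix (Fin n) (Fin d) ℝ → ℝ := fun C => ∑ k ∈ I, rowCompl (M + C) k k with hT
  have hT1 : ∫ C, T C ∂μ = D * ∫ C, rowCompl (M + C) i i ∂μ := by
    rw [hT, integral_finsetSum _ fun k _ => integrable_rowCompl v M k k,
      Finset.sum_congr rfl fun k hk => integral_rowCompl_diag_eq v M (f := fun x => x)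
        measurable_id (hI i hi) (hI k hk)]
    simp [hD, μ]
  have hTint : Integrable T μ := integrable_finsetSum _ fun k _ => integrable_rowCompl v M k k
  have hT2e : ∀ C, T C ^ 2 = ∑ k ∈ I, ∑ l ∈ I, rowCompl (M + C) k k * rowCompl (M + C) l l := by
    intro C; rw [pow_two, Finset.sum_mul_sum]
  have hT2int : Integrable (fun C => T C ^ 2) μ := by
    simp_rw [hT2e]
    exact integrable_finsetSum _ fun k _ => integrable_finsetSum _ fun l _ =>
      integrable_rowCompl_mul v M k k l l
  have hkl : ∀ k l, Integrable (fun C => rowCompl (M + C) k k * rowCompl (M + C) l l +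
      2 * rowCompl (M + C) k l ^ 2) μ := fun k l =>
    (integrable_rowCompl_mul v M k k l l).add ((hsq k l).const_mul 2)
  have hT2 : D ^ 2 * ∫ C, rowCompl (M + C) i i ^ 2 ∂μ ≤ ∫ C, (T C ^ 2 + 2 * d) ∂μ := by
    calc D ^ 2 * ∫ C, rowCompl (M + C) i i ^ 2 ∂μ
        = ∑ k ∈ I, ∑ l ∈ I, ∫ C, rowCompl (M + C) i i ^ 2 ∂μ := by
          simp [hD, pow_two, mul_assoc]
      _ ≤ ∑ k ∈ I, ∑ l ∈ I, ∫ C, (rowCompl (M + C) k k * rowCompl (M + C) l l +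
            2 * rowCompl (M + C) k l ^ 2) ∂μ :=
          Finset.sum_le_sum fun k hk => Finset.sum_le_sum fun l hl =>
            integral_rowCompl_diag_sq_le v M (hI i hi) (hI k hk) (hI l hl)
      _ = ∫ C, ∑ k ∈ I, ∑ l ∈ I, (rowCompl (M + C) k k * rowCompl (M + C) l l +
            2 * rowCompl (M + C) k l ^ 2) ∂μ := by
          rw [integral_finsetSum _ fun k _ => integrable_finsetSum _ fun l _ => hkl k l]
          exact Finset.sum_congr rfl fun k _ => (integral_finsetSum _ fun l _ => hkl k l).symm
      _ ≤ ∫ C, (T C ^ 2 + 2 * d) ∂μ := by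
          refine integral_mono (integrable_finsetSum _ fun k _ => integrable_finsetSum _ fun l _ =>
            hkl k l) (hT2int.add (integrable_const _)) fun C => ?_
          simp only [Finset.sum_add_distrib, hT2e, ← Finset.mul_sum]
          gcongr
          calc ∑ k ∈ I, ∑ l ∈ I, rowCompl (M + C) k l ^ 2
              ≤ ∑ k ∈ I, ∑ l, rowCompl (M + C) k l ^ 2 :=
                Finset.sum_le_sum fun k _ => Finset.sum_le_sum_of_subset_of_nonneg
                  (Finset.subset_univ _) fun _ _ _ => sq_nonneg _
            _ ≤ ∑ k ∈ I, 1 := Finset.sum_le_sum fun k _ => by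
                refine le_trans (le_of_eq ?_) (rowCompl_diag_le_one (M + C) k)
                rw [rowCompl_apply_eq]; simp_rw [pow_two]
            _ ≤ d := by
                rw [Finset.sum_const, nsmul_eq_mul, mul_one]
                have := Finset.card_le_univ I
                rw [Fintype.card_fin] at this
                exact_mod_cast this
  have hT3 : ∀ᵐ C ∂μ, (T C - D * τ) ^ 2 ≤ (r : ℝ) ^ 2 := by
    filter_upwards [ae_isUnit_det_gram hv hnd M] with C hC
    have htr : T C + ∑ k ∈ Iᶜ, rowCompl (M + C) k k = d - n := by
      rw [hT, ← trace_rowCompl hC, Matrix.trace]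
      exact Finset.sum_add_sum_compl I _
    have hX0 : 0 ≤ ∑ k ∈ Iᶜ, rowCompl (M + C) k k :=
      Finset.sum_nonneg fun k _ => rowCompl_diag_nonneg _ k
    have hX1 : ∑ k ∈ Iᶜ, rowCompl (M + C) k k ≤ Iᶜ.card := by
      refine (Finset.sum_le_sum fun k _ => rowCompl_diag_le_one (M + C) k).trans ?_
      simp
    have hr' : (Iᶜ.card : ℝ) ≤ r := by exact_mod_cast hr
    have hcard : D + Iᶜ.card = d := by
      have := Finset.card_add_card_compl I
      rw [Fintype.card_fin] at this
      rw [hD]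
      exact_mod_cast this
    have hτ0 : 0 ≤ τ := div_nonneg (by linarith) hd0.le
    have hτ1 : τ ≤ 1 := by
      rw [hτ, div_le_one hd0]
      have : (0 : ℝ) ≤ n := Nat.cast_nonneg n
      linarith
    have hdτ : d * τ = d - n := by rw [hτ]; field_simp
    have he : T C - D * τ = Iᶜ.card * τ - ∑ k ∈ Iᶜ, rowCompl (M + C) k k := by
      have : D = d - Iᶜ.card := by linarith
      rw [this, sub_mul, hdτ]
      linarith
    have hc0 : (0 : ℝ) ≤ Iᶜ.card := Nat.cast_nonneg _
    refine sq_le_sq' ?_ ?_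
    · rw [he]; nlinarith
    · rw [he]; nlinarith
  have hmain : D ^ 2 * ∫ C, (rowCompl (M + C) i i - τ) ^ 2 ∂μ =
      D ^ 2 * (∫ C, rowCompl (M + C) i i ^ 2 ∂μ) - 2 * τ * D * (∫ C, T C ∂μ) + D ^ 2 * τ ^ 2 := by
    rw [(integral_sub_const_sq (integrable_rowCompl v M i i) (hsq i i) τ).2, hT1]
    ring
  obtain ⟨h1, hfin⟩ := integral_sub_const_sq hTint hT2int (D * τ)
  have hle : ∫ C, (T C - D * τ) ^ 2 ∂μ ≤ (r : ℝ) ^ 2 := by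
    refine (integral_mono_ae h1 (integrable_const ((r : ℝ) ^ 2)) hT3).trans ?_
    simp [μ]
  rw [integral_add hT2int (integrable_const _)] at hT2
  simp only [integral_const, probReal_univ, smul_eq_mul, one_mul, μ] at hT2
  linarith

end

theorem exists_orthogonal_submatrix_eq {m r : ℕ} (hr : r ≤ m) (U : Matrix (Fin m) (Fin r) ℝ)
    (hU : Uᵀ * U = 1) :
    ∃ O ∈ Matrix.orthogonalGroup (Fin m) ℝ, O.submatrix id (Fin.castLE hr) = U := by
  set w : Fin m → EuclideanSpace ℝ (Fin m) := fun k =>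
    if h : k.val < r then WithLp.toLp 2 fun l => U l ⟨k, h⟩ else 0 with hw
  set s : Set (Fin m) := {k | k.val < r} with hs
  have hws : ∀ k (h : k ∈ s), w k = WithLp.toLp 2 fun l => U l ⟨k, h⟩ := fun k h => dif_pos h
  have horth : Orthonormal ℝ (s.domRestrict w) := by
    rw [orthonormal_iff_ite]
    rintro ⟨k, hk⟩ ⟨l, hl⟩
    have h1 := congrFun (congrFun hU ⟨l, hl⟩) ⟨k, hk⟩
    rw [Matrix.mul_apply, Matrix.one_apply] at h1
    change inner ℝ (w k) (w l) = _
    rw [hws k hk, hws l hl, PiLp.inner_apply]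
    simp only [RCLike.inner_apply, conj_trivial]
    refine h1.trans ?_
    simp [Fin.ext_iff, eq_comm]
  obtain ⟨b, hb⟩ := horth.exists_orthonormalBasis_extension_of_card_eq (by simp)
  refine ⟨Matrix.of fun k l => b l k, ?_, ?_⟩
  · rw [Matrix.mem_orthogonalGroup_iff']
    ext k l
    have h1 := orthonormal_iff_ite.1 b.orthonormal l k
    rw [Matrix.mul_apply, Matrix.one_apply]
    simp only [PiLp.inner_apply, RCLike.inner_apply, conj_trivial] at h1
    refine Eq.trans ?_ (h1.trans ?_)
    · rfl
    · simp [eq_comm]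
  · ext k j
    have hj : Fin.castLE hr j ∈ s := j.2
    simp [hb _ hj, hws _ hj]

theorem frobSq_eq_trace {m n : ℕ} (W : Matrix (Fin m) (Fin n) ℝ) :
    frobSq W = Matrix.trace (W * Wᵀ) := by
  simp [frobSq, Matrix.trace, Matrix.mul_apply, pow_two]

theorem frobSq_Wmat {d N r : ℕ} (σ : Fin r → ℝ) (U : Matrix (Fin d) (Fin r) ℝ)
    (V : Matrix (Fin N) (Fin r) ℝ) (hU : Uᵀ * U = 1) (A : Matrix (Fin d) (Fin N) ℝ) :
    frobSq (Wmat (U * Matrix.diagonal σ * Vᵀ) A) = ∑ j, σ j ^ 2 *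
      (Vᵀ * ((U * Matrix.diagonal σ * Vᵀ + A)ᵀ * (U * Matrix.diagonal σ * Vᵀ + A))⁻¹ * V) j j := by
  set X := U * Matrix.diagonal σ * Vᵀ with hX
  set H := ((X + A)ᵀ * (X + A))⁻¹ with hH
  have hHt : Hᵀ = H := by
    rw [hH, Matrix.transpose_nonsing_inv, Matrix.transpose_mul, Matrix.transpose_transpose]
  have hHGH : H * ((X + A)ᵀ * (X + A)) * H = H := nonsing_inv_mul_mul_nonsing_inv _
  have h1 : Wmat X A * (Wmat X A)ᵀ = X * H * Xᵀ := by
    rw [Wmat, ← hH, Matrix.transpose_mul, Matrix.transpose_mul, Matrix.transpose_transpose, hHt]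
    conv_rhs => rw [← hHGH]
    simp only [Matrix.mul_assoc]
  have h2 : X * H * Xᵀ = U * (Matrix.diagonal σ * (Vᵀ * H * V) * Matrix.diagonal σ * Uᵀ) := by
    rw [hX]
    simp only [Matrix.transpose_mul, Matrix.transpose_transpose, Matrix.diagonal_transpose,
      Matrix.mul_assoc]
  rw [frobSq_eq_trace, h1, h2, Matrix.trace_mul_comm, Matrix.mul_assoc, hU, Matrix.mul_one,
    Matrix.trace]
  refine Finset.sum_congr rfl fun j _ => ?_
  rw [Matrix.diag_apply, Matrix.mul_diagonal, Matrix.diagonal_mul]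
  ring

/-- The rectangular matrix with diagonal entries `σ` and zeros elsewhere. -/
def rectDiagonal {n d r : ℕ} (hn : r ≤ n) (hd : r ≤ d) (σ : Fin r → ℝ) :
    Matrix (Fin n) (Fin d) ℝ :=
  (1 : Matrix (Fin n) (Fin n) ℝ).submatrix id (Fin.castLE hn) * Matrix.diagonal σ *
    (1 : Matrix (Fin d) (Fin d) ℝ).submatrix (Fin.castLE hd) id

section

variable {n d r : ℕ} (hn : r ≤ n) (hd : r ≤ d) (σ : Fin r → ℝ)

theorem rectDiagonal_apply (k : Fin n) (l : Fin d) :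
    rectDiagonal hn hd σ k l =
      ∑ j, (if k = Fin.castLE hn j then σ j else 0) * if Fin.castLE hd j = l then 1 else 0 := by
  rw [rectDiagonal, Matrix.mul_apply]
  refine Finset.sum_congr rfl fun j _ => ?_
  rw [Matrix.mul_diagonal]
  simp [Matrix.one_apply]

theorem rectDiagonal_castLE (j : Fin r) :
    rectDiagonal hn hd σ (Fin.castLE hn j) = σ j • Pi.single (Fin.castLE hd j) 1 := by
  ext l
  rw [rectDiagonal_apply, Finset.sum_eq_single j]
  · simp [Pi.single_apply, eq_comm]
  · intro k _ hk
    have : ¬ Fin.castLE hn j = Fin.castLE hn k := fun h => hk (Fin.castLE_injective hn h).symm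
    simp [this]
  · simp

theorem rectDiagonal_eq_zero {k : Fin n} {l : Fin d} (h : r ≤ l.val ∨ k.val ≠ l.val) :
    rectDiagonal hn hd σ k l = 0 := by
  rw [rectDiagonal_apply]
  refine Finset.sum_eq_zero fun j _ => ?_
  by_cases h1 : k = Fin.castLE hn j
  · by_cases h2 : Fin.castLE hd j = l
    · exfalso
      subst h1 h2
      have := j.2
      simp at h
      omega
    · simp [h2]
  · simp [h1]

theorem measurable_frobSq_Wmat (X : Matrix (Fin d) (Fin n) ℝ) :
    Measurable fun A : Matrix (Fin d) (Fin n) ℝ => frobSq (Wmat X A) := by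
  have h1 : Measurable fun A : Matrix (Fin d) (Fin n) ℝ => X + A :=
    measurable_const.matrix_add measurable_id
  have h2 : Measurable fun A : Matrix (Fin d) (Fin n) ℝ => Wmat X A :=
    measurable_const.matrix_mul
      ((h1.matrix_transpose.matrix_mul h1).matrix_inv.matrix_mul h1.matrix_transpose)
  exact Finset.measurable_fun_sum _ fun i _ => Finset.measurable_fun_sum _ fun j _ =>
    (h2.matrix_entry i j).pow_const 2

theorem frobSq_Wmat_orthogonal {U : Matrix (Fin d) (Fin r) ℝ} {V : Matrix (Fin n) (Fin r) ℝ}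
    (hU : Uᵀ * U = 1) {O : Matrix (Fin d) (Fin d) ℝ} (hO : O ∈ Matrix.orthogonalGroup (Fin d) ℝ)
    {P : Matrix (Fin n) (Fin n) ℝ} (hP : P ∈ Matrix.orthogonalGroup (Fin n) ℝ)
    (hOU : O.submatrix id (Fin.castLE hd) = U) (hPV : P.submatrix id (Fin.castLE hn) = V)
    (B : Matrix (Fin n) (Fin d) ℝ) :
    frobSq (Wmat (U * Matrix.diagonal σ * Vᵀ) (O * Bᵀ * Pᵀ)) = ∑ j, σ j ^ 2 *
      ((rectDiagonal hn hd σ + B) * (rectDiagonal hn hd σ + B)ᵀ)⁻¹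
        (Fin.castLE hn j) (Fin.castLE hn j) := by
  have hO1 : Oᵀ * O = 1 := (Matrix.mem_orthogonalGroup_iff' _ _).1 hO
  have hP1 : Pᵀ * P = 1 := (Matrix.mem_orthogonalGroup_iff' _ _).1 hP
  have hP2 : P * Pᵀ = 1 := (Matrix.mem_orthogonalGroup_iff _ _).1 hP
  set M := rectDiagonal hn hd σ with hM
  have hU' : U = O * (1 : Matrix (Fin d) (Fin d) ℝ).submatrix id (Fin.castLE hd) := by
    rw [← hOU]
    conv_rhs => rw [← Matrix.submatrix_id_id O]
    rw [← Matrix.submatrix_mul _ _ _ _ _ Function.bijective_id, Matrix.mul_one]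
  have hV' : V = P * (1 : Matrix (Fin n) (Fin n) ℝ).submatrix id (Fin.castLE hn) := by
    rw [← hPV]
    conv_rhs => rw [← Matrix.submatrix_id_id P]
    rw [← Matrix.submatrix_mul _ _ _ _ _ Function.bijective_id, Matrix.mul_one]
  have hX : U * Matrix.diagonal σ * Vᵀ = O * Mᵀ * Pᵀ := by
    rw [hM, rectDiagonal, hV', hU']
    simp only [Matrix.transpose_mul, Matrix.diagonal_transpose, Matrix.transpose_submatrix,
      Matrix.transpose_one, Matrix.mul_assoc]
  have hXA : U * Matrix.diagonal σ * Vᵀ + O * Bᵀ * Pᵀ = O * (M + B)ᵀ * Pᵀ := by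
    rw [hX, Matrix.transpose_add, Matrix.mul_add, Matrix.add_mul]
  rw [frobSq_Wmat σ U V hU, hXA]
  have hG : (O * (M + B)ᵀ * Pᵀ)ᵀ * (O * (M + B)ᵀ * Pᵀ) =
      P * ((M + B) * (M + B)ᵀ) * Pᵀ := by
    simp only [Matrix.transpose_mul, Matrix.transpose_transpose, Matrix.mul_assoc]
    rw [← Matrix.mul_assoc Oᵀ O, hO1, Matrix.one_mul]
  have hPinv : P⁻¹ = Pᵀ := Matrix.inv_eq_left_inv hP1
  have hPtinv : Pᵀ⁻¹ = P := Matrix.inv_eq_left_inv hP2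
  set K := ((M + B) * (M + B)ᵀ)⁻¹ with hK
  have hH : (P * ((M + B) * (M + B)ᵀ) * Pᵀ)⁻¹ = P * K * Pᵀ := by
    rw [Matrix.mul_inv_rev, Matrix.mul_inv_rev, hPinv, hPtinv, ← hK, Matrix.mul_assoc]
  have hVHV : Vᵀ * (P * K * Pᵀ) * V = K.submatrix (Fin.castLE hn) (Fin.castLE hn) := by
    have h1 : Vᵀ * (P * K * Pᵀ) * V =
        (1 : Matrix (Fin n) (Fin n) ℝ).submatrix (Fin.castLE hn) id * K *
          (1 : Matrix (Fin n) (Fin n) ℝ).submatrix id (Fin.castLE hn) := by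
      rw [hV', Matrix.transpose_mul, Matrix.transpose_submatrix, Matrix.transpose_one]
      simp only [Matrix.mul_assoc]
      rw [← Matrix.mul_assoc Pᵀ P, hP1, Matrix.one_mul, ← Matrix.mul_assoc Pᵀ P, hP1,
        Matrix.one_mul]
    rw [h1]
    conv_lhs => rw [← Matrix.submatrix_id_id K]
    rw [← Matrix.submatrix_mul _ _ _ _ _ Function.bijective_id,
      ← Matrix.submatrix_mul _ _ _ _ _ Function.bijective_id, Matrix.mul_one, Matrix.one_mul]
  rw [hG, hH, hVHV]
  rfl

theorem gram_inv_diag_nonneg (R : Matrix (Fin n) (Fin d) ℝ) (i : Fin n) :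
    0 ≤ (R * Rᵀ)⁻¹ i i := by
  have hHt : ((R * Rᵀ)⁻¹)ᵀ = (R * Rᵀ)⁻¹ := by
    rw [Matrix.transpose_nonsing_inv, Matrix.transpose_mul, Matrix.transpose_transpose]
  have h : (R * Rᵀ)⁻¹ = ((R * Rᵀ)⁻¹ * R) * ((R * Rᵀ)⁻¹ * R)ᵀ := by
    rw [Matrix.transpose_mul, hHt]
    conv_lhs => rw [← nonsing_inv_mul_mul_nonsing_inv (R * Rᵀ)]
    simp only [Matrix.mul_assoc]
  rw [h, Matrix.mul_apply]
  exact Finset.sum_nonneg fun j _ => mul_self_nonneg _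

theorem lintegral_frobSq_Wmat (v : NNReal) {U : Matrix (Fin d) (Fin r) ℝ}
    {V : Matrix (Fin n) (Fin r) ℝ} (hU : Uᵀ * U = 1) (hV : Vᵀ * V = 1) :
    ∫⁻ A, ENNReal.ofReal (frobSq (Wmat (U * Matrix.diagonal σ * Vᵀ) A)) ∂(gaussMatrix d n v) =
      ∑ j, ENNReal.ofReal (σ j ^ 2) * ∫⁻ B, ENNReal.ofReal
        (((rectDiagonal hn hd σ + B) * (rectDiagonal hn hd σ + B)ᵀ)⁻¹
          (Fin.castLE hn j) (Fin.castLE hn j)) ∂(gaussMatrix n d v) := by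
  obtain ⟨O, hO, hOU⟩ := exists_orthogonal_submatrix_eq hd U hU
  obtain ⟨P, hP, hPV⟩ := exists_orthogonal_submatrix_eq hn V hV
  have hPt : Pᵀ ∈ Matrix.orthogonalGroup (Fin n) ℝ := by
    rw [Matrix.mem_orthogonalGroup_iff, Matrix.transpose_transpose]
    exact (Matrix.mem_orthogonalGroup_iff' _ _).1 hP
  have hF : Measurable fun A : Matrix (Fin d) (Fin n) ℝ =>
      ENNReal.ofReal (frobSq (Wmat (U * Matrix.diagonal σ * Vᵀ) A)) :=
    (measurable_frobSq_Wmat _).ennreal_ofReal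
  have ht : Measurable fun A : Matrix (Fin n) (Fin d) ℝ => Aᵀ := measurable_id.matrix_transpose
  have hl : Measurable fun A : Matrix (Fin d) (Fin n) ℝ => O * A :=
    measurable_const.matrix_mul measurable_id
  have hr : Measurable fun A : Matrix (Fin d) (Fin n) ℝ => A * Pᵀ :=
    measurable_id.matrix_mul measurable_const
  have hmap : ((gaussMatrix n d v).map fun B => O * Bᵀ * Pᵀ) = gaussMatrix d n v := by
    conv_rhs => rw [← map_mul_right_gaussMatrix v Pᵀ hPt, ← map_mul_left_gaussMatrix v O hO,
      ← map_transpose_gaussMatrix n d v]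
    rw [Measure.map_map hl ht, Measure.map_map hr (hl.comp ht)]
    rfl
  have hH : ∀ j, Measurable fun B : Matrix (Fin n) (Fin d) ℝ => ENNReal.ofReal
        (((rectDiagonal hn hd σ + B) * (rectDiagonal hn hd σ + B)ᵀ)⁻¹
          (Fin.castLE hn j) (Fin.castLE hn j)) := fun j => by
    have h1 : Measurable fun B : Matrix (Fin n) (Fin d) ℝ => rectDiagonal hn hd σ + B :=
      measurable_const.matrix_add measurable_id
    exact ((h1.matrix_mul h1.matrix_transpose).matrix_inv.matrix_entry _ _).ennreal_ofReal
  conv_lhs => rw [← hmap]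
  refine (lintegral_map hF (hr.comp (hl.comp ht))).trans ?_
  have hpt : ∀ B : Matrix (Fin n) (Fin d) ℝ,
      ENNReal.ofReal (frobSq (Wmat (U * Matrix.diagonal σ * Vᵀ) (O * Bᵀ * Pᵀ))) =
      ∑ j, ENNReal.ofReal (σ j ^ 2) * ENNReal.ofReal
        (((rectDiagonal hn hd σ + B) * (rectDiagonal hn hd σ + B)ᵀ)⁻¹
          (Fin.castLE hn j) (Fin.castLE hn j)) := by
    intro B
    rw [frobSq_Wmat_orthogonal hn hd σ hU hO hP hOU hPV, ENNReal.ofReal_sum_of_nonneg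
      fun j _ => mul_nonneg (sq_nonneg _) (gram_inv_diag_nonneg _ _)]
    exact Finset.sum_congr rfl fun j _ => ENNReal.ofReal_mul (sq_nonneg _)
  refine (lintegral_congr hpt).trans ?_
  rw [lintegral_finsetSum _ fun j _ => (hH j).const_mul _]
  exact Finset.sum_congr rfl fun j _ => lintegral_const_mul _ (hH j)

end

/-- The energy of a coordinate vector in the orthogonal complement of the other rows: its law
determines the diagonal of the inverse Gram matrix. -/
theorem exists_law_lintegral_gram_inv_diag {n d r : ℕ} {v : NNReal} (hv : v ≠ 0) (hnd : n < d)
    (hn : r ≤ n + 1) (hd : r ≤ d) (σ : Fin r → ℝ) (j : Fin r) :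
    ∃ μ : Measure ℝ, IsProbabilityMeasure μ ∧ (∀ᵐ q ∂μ, 0 ≤ q ∧ q ≤ 1) ∧
      ((d : ℝ) - r) ^ 2 * ∫ q, (q - ((d : ℝ) - n) / d) ^ 2 ∂μ ≤ (r : ℝ) ^ 2 + 2 * d ∧
      ∫⁻ B, ENNReal.ofReal (((rectDiagonal hn hd σ + B) * (rectDiagonal hn hd σ + B)ᵀ)⁻¹
          (Fin.castLE hn j) (Fin.castLE hn j)) ∂(gaussMatrix (n + 1) d v) =
        ∫⁻ t in Set.Ioi 0, ∫⁻ q, ENNReal.ofReal ((√(1 + 2 * t * v))⁻¹ ^ (d - n) *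
          Real.exp (-(t * σ j ^ 2 * q / (1 + 2 * t * v)))) ∂μ := by
  set i := Fin.castLE hn j with hi
  set k := Fin.castLE hd j with hk
  set M := (rectDiagonal hn hd σ).submatrix i.succAbove id with hM
  have hm : Measurable fun C : Matrix (Fin n) (Fin d) ℝ => rowCompl (M + C) k k :=
    measurable_rowCompl_add_apply M k k
  refine ⟨(gaussMatrix n d v).map fun C => rowCompl (M + C) k k,
    Measure.isProbabilityMeasure_map hm.aemeasurable, ?_, ?_, ?_⟩
  · rw [ae_map_iff hm.aemeasurable (measurableSet_Icc (a := (0 : ℝ)) (b := 1))]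
    exact ae_of_all _ fun C => ⟨rowCompl_diag_nonneg _ _, rowCompl_diag_le_one _ _⟩
  · have hint : ∫ q, (q - ((d : ℝ) - n) / d) ^ 2
        ∂((gaussMatrix n d v).map fun C => rowCompl (M + C) k k) =
        ∫ C, (rowCompl (M + C) k k - ((d : ℝ) - n) / d) ^ 2 ∂(gaussMatrix n d v) :=
      integral_map hm.aemeasurable (by fun_prop)
    rw [hint]
    set I : Finset (Fin d) := Finset.univ.filter fun l => r ≤ l.val ∨ l = k with hI
    have hIc : Iᶜ.card ≤ r := by
      have : Iᶜ ⊆ Finset.univ.image (Fin.castLE hd) := by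
        intro l hl
        simp only [hI, Finset.mem_compl, Finset.mem_filter, Finset.mem_univ, true_and, not_or,
          not_le] at hl
        exact Finset.mem_image.2 ⟨⟨l, hl.1⟩, Finset.mem_univ _, by ext; rfl⟩
      exact (Finset.card_le_card this).trans (Finset.card_image_le.trans (by simp))
    have hle := integral_rowCompl_diag_sub_sq_le M hv hnd.le I (i := k) (r := r) ?_
      (by simp [hI]) hIc
    · refine le_trans ?_ hle
      have hcard : (d : ℝ) ≤ I.card + r := by
        have := Finset.card_add_card_compl I
        rw [Fintype.card_fin] at this
        exact_mod_cast (by omega : d ≤ I.card + r)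
      have hrd : (r : ℝ) ≤ d := by exact_mod_cast hd
      refine mul_le_mul_of_nonneg_right ?_ (integral_nonneg fun C => sq_nonneg _)
      exact pow_le_pow_left₀ (by linarith) (by linarith) 2
    · intro l hl a
      refine rectDiagonal_eq_zero hn hd σ ?_
      simp only [hI, Finset.mem_filter, Finset.mem_univ, true_and] at hl
      refine hl.imp_right fun h => ?_
      have hne := Fin.succAbove_ne i a
      intro h'
      refine hne (Fin.ext ?_)
      rw [h] at h'
      exact h'
  · rw [lintegral_gram_inv_diag hv hnd]
    refine lintegral_congr fun t => ?_
    rw [← hM, lintegral_map (by fun_prop) hm]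
    refine lintegral_congr fun C => ?_
    have h1 : rectDiagonal hn hd σ i ⬝ᵥ rowCompl (M + C) *ᵥ rectDiagonal hn hd σ i =
        σ j ^ 2 * rowCompl (M + C) k k := by
      rw [hi, rectDiagonal_castLE, smul_dotProduct, Matrix.mulVec_smul, dotProduct_smul,
        ← rowCompl_apply_eq_form]
      simp only [smul_eq_mul]
      ring
    rw [h1, ← mul_assoc t]

theorem Real.abs_exp_neg_sub_exp_neg_le {x y : ℝ} (hx : 0 ≤ x) (hy : 0 ≤ y) :
    |Real.exp (-x) - Real.exp (-y)| ≤ |x - y| := by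
  wlog h : x ≤ y generalizing x y
  · rw [abs_sub_comm, abs_sub_comm x]
    exact this hy hx (le_of_not_ge h)
  have h1 : Real.exp (-y) = Real.exp (-x) * Real.exp (-(y - x)) := by
    rw [← Real.exp_add]; ring_nf
  have h2 := Real.one_sub_le_exp_neg (y - x)
  have h3 : Real.exp (-x) ≤ 1 := Real.exp_le_one_iff.2 (by linarith)
  have h4 := Real.exp_pos (-x)
  have h5 : Real.exp (-y) ≤ Real.exp (-x) := Real.exp_le_exp.2 (by linarith)
  rw [abs_of_nonneg (by linarith), abs_of_nonpos (by linarith), h1]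
  nlinarith

theorem abs_integral_exp_neg_mul_sub_le {μ : Measure ℝ} [IsProbabilityMeasure μ]
    (hμ : ∀ᵐ q ∂μ, 0 ≤ q ∧ q ≤ 1) {u τ : ℝ} (hu : 0 ≤ u) (hτ : 0 ≤ τ) :
    |(∫ q, Real.exp (-(u * q)) ∂μ) - Real.exp (-(u * τ))| ≤ u * √(∫ q, (q - τ) ^ 2 ∂μ) := by
  have hexp : Integrable (fun q => Real.exp (-(u * q))) μ := by
    refine Integrable.of_bound (C := 1) (by fun_prop) ?_
    filter_upwards [hμ] with q hq
    rw [Real.norm_eq_abs, abs_of_pos (Real.exp_pos _)]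
    exact Real.exp_le_one_iff.2 (by nlinarith [hq.1])
  have habs : Integrable (fun q => |q - τ|) μ := by
    refine Integrable.of_bound (C := 1 + τ) (by fun_prop) ?_
    filter_upwards [hμ] with q hq
    rw [Real.norm_eq_abs, abs_abs, abs_le]
    constructor <;> linarith [hq.1, hq.2]
  have hsq : Integrable (fun q => |q - τ| ^ 2) μ := by
    refine Integrable.of_bound (C := (1 + τ) ^ 2) (by fun_prop) ?_
    filter_upwards [hμ] with q hq
    rw [Real.norm_eq_abs, abs_pow, abs_abs]
    refine pow_le_pow_left₀ (abs_nonneg _) ?_ 2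
    rw [abs_le]
    constructor <;> linarith [hq.1, hq.2]
  have hcs : ∫ q, |q - τ| ∂μ ≤ √(∫ q, (q - τ) ^ 2 ∂μ) := by
    refine Real.le_sqrt_of_sq_le ?_
    have h1 := (integral_sub_const_sq habs hsq (∫ q, |q - τ| ∂μ)).2
    have h2 : 0 ≤ ∫ q, (|q - τ| - ∫ q, |q - τ| ∂μ) ^ 2 ∂μ := integral_nonneg fun _ => sq_nonneg _
    simp only [sq_abs] at h1
    linarith
  have h1 : (∫ q, Real.exp (-(u * q)) ∂μ) - Real.exp (-(u * τ)) =
      ∫ q, (Real.exp (-(u * q)) - Real.exp (-(u * τ))) ∂μ := by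
    rw [integral_sub hexp (integrable_const _)]
    simp
  rw [h1, ← Real.norm_eq_abs]
  calc ‖∫ q, (Real.exp (-(u * q)) - Real.exp (-(u * τ))) ∂μ‖
      ≤ ∫ q, u * |q - τ| ∂μ := by
        refine norm_integral_le_of_norm_le (habs.const_mul u) ?_
        filter_upwards [hμ] with q hq
        rw [Real.norm_eq_abs]
        refine (Real.abs_exp_neg_sub_exp_neg_le (mul_nonneg hu hq.1) (mul_nonneg hu hτ)).trans ?_
        rw [← mul_sub, abs_mul, abs_of_nonneg hu]
    _ = u * ∫ q, |q - τ| ∂μ := integral_const_mul _ _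
    _ ≤ _ := mul_le_mul_of_nonneg_left hcs hu

theorem lintegral_exp_neg_mul_Ioi {b : ℝ} (hb : 0 < b) :
    ∫⁻ t in Set.Ioi 0, ENNReal.ofReal (Real.exp (-b * t)) = ENNReal.ofReal (1 / b) := by
  rw [← ofReal_integral_eq_lintegral_ofReal (integrableOn_exp_mul_Ioi (by linarith) 0)
    (ae_of_all _ fun t => (Real.exp_pos _).le), integral_exp_mul_Ioi (by linarith)]
  simp [neg_div_neg_eq]

section

variable {e : ℕ → ℕ} {κ a : ℝ}

theorem tendsto_inv_sqrt_pow (hE : Tendsto (fun n => (e n : ℝ)) atTop atTop)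
    (hκ : Tendsto (fun n => ((e n : ℝ) - n) / e n) atTop (nhds κ)) (hlt : ∀ᶠ n in atTop, n < e n)
    (ha : 0 < a) {t : ℝ} (ht : 0 < t) :
    Tendsto (fun n => (√(1 + 2 * t * (a / e n)))⁻¹ ^ (e n - n)) atTop
      (nhds (Real.exp (-(t * a * κ)))) := by
  have h1 : Tendsto (fun n => (e n : ℝ) * Real.log (1 + (2 * t * a) / e n)) atTop
      (nhds (2 * t * a)) := (Real.tendsto_mul_log_one_add_div_atTop (2 * t * a)).comp hE
  have h2 : Tendsto (fun n => Real.exp (-(1 / 2 * (((e n : ℝ) - n) / e n *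
      ((e n : ℝ) * Real.log (1 + (2 * t * a) / e n)))))) atTop
      (nhds (Real.exp (-(1 / 2 * (κ * (2 * t * a)))))) :=
    (Real.continuous_exp.tendsto _).comp (((hκ.mul h1).const_mul _).neg)
  have h3 : 1 / 2 * (κ * (2 * t * a)) = t * a * κ := by ring
  rw [h3] at h2
  refine h2.congr' ?_
  filter_upwards [hlt] with n hn
  have he : (0 : ℝ) < e n := by exact_mod_cast (Nat.zero_le n).trans_lt hn
  have hb : 0 < 1 + 2 * t * (a / e n) := by positivity
  have hb' : 1 + 2 * t * a / e n = 1 + 2 * t * (a / e n) := by ring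
  rw [hb', ← Real.exp_log (pow_pos (inv_pos.2 (Real.sqrt_pos.2 hb)) (e n - n)), Real.log_pow,
    Real.log_inv, Real.log_sqrt hb.le, Nat.cast_sub hn.le]
  congr 1
  field_simp

theorem eventually_inv_sqrt_pow_le (hE : Tendsto (fun n => (e n : ℝ)) atTop atTop)
    (hκ0 : 0 < κ) (hκ : Tendsto (fun n => ((e n : ℝ) - n) / e n) atTop (nhds κ))
    (hlt : ∀ᶠ n in atTop, n < e n) (ha : 0 < a) :
    ∀ᶠ n in atTop, ∀ t : ℝ, 0 < t → (√(1 + 2 * t * (a / e n)))⁻¹ ^ (e n - n) ≤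
      (1 + (κ * a / 8 * t) ^ 2)⁻¹ := by
  filter_upwards [hlt, hκ.eventually (lt_mem_nhds (half_lt_self hκ0)),
    hE.eventually_ge_atTop (12 / κ)] with n hn hτ hen t ht
  have he : (0 : ℝ) < e n := by exact_mod_cast (Nat.zero_le n).trans_lt hn
  set b := 1 + 2 * t * (a / e n) with hb
  have hb1 : 1 ≤ b := by
    have : 0 ≤ 2 * t * (a / e n) := by positivity
    linarith
  set k := (e n - n) / 4 with hk
  have hk4 : 4 * k ≤ e n - n := Nat.mul_div_le _ _
  have hk' : e n ≤ n + 4 * k + 3 := by omega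
  have hkr : κ / 16 * e n ≤ k := by
    have h1 : (e n : ℝ) ≤ n + 4 * k + 3 := by exact_mod_cast hk'
    rw [lt_div_iff₀ he] at hτ
    rw [div_le_iff₀ hκ0] at hen
    nlinarith
  have hsq1 : 1 ≤ √b := Real.one_le_sqrt.2 hb1
  have hpow : 1 + (κ * a / 8 * t) ^ 2 ≤ √b ^ (e n - n) := by
    calc 1 + (κ * a / 8 * t) ^ 2 ≤ (1 + κ * a / 8 * t) ^ 2 := by
          have : 0 ≤ κ * a / 8 * t := by positivity
          nlinarith
      _ ≤ (1 + k * (2 * t * (a / e n))) ^ 2 := by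
          refine pow_le_pow_left₀ (by positivity) ?_ 2
          have : κ * a / 8 * t = κ / 16 * e n * (2 * t * (a / e n)) := by field_simp; ring
          rw [this]
          gcongr
      _ ≤ (b ^ k) ^ 2 := by
          refine pow_le_pow_left₀ (by positivity) ?_ 2
          refine one_add_mul_le_pow ?_ k
          have : 0 ≤ 2 * t * (a / e n) := by positivity
          linarith
      _ = √b ^ (4 * k) := by
          conv_lhs => rw [← Real.sq_sqrt (zero_le_one.trans hb1)]
          rw [← pow_mul, ← pow_mul]
          congr 1
          omega
      _ ≤ √b ^ (e n - n) := pow_le_pow_right₀ hsq1 hk4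
  rw [inv_pow]
  exact inv_anti₀ (by positivity) hpow

theorem tendsto_lintegral_of_concentration {r : ℕ} {s : ℝ}
    (hE : Tendsto (fun n => (e n : ℝ)) atTop atTop)
    (hκ0 : 0 < κ) (hκ : Tendsto (fun n => ((e n : ℝ) - n) / e n) atTop (nhds κ))
    (hlt : ∀ᶠ n in atTop, n < e n) (ha : 0 < a) (hs : 0 < s) (μ : ℕ → Measure ℝ)
    (hprob : ∀ n, IsProbabilityMeasure (μ n))
    (hμ : ∀ᶠ n in atTop, (∀ᵐ q ∂(μ n), 0 ≤ q ∧ q ≤ 1) ∧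
      ((e n : ℝ) - r) ^ 2 * ∫ q, (q - ((e n : ℝ) - n) / e n) ^ 2 ∂(μ n) ≤ (r : ℝ) ^ 2 + 2 * e n) :
    Tendsto (fun n => ∫⁻ t in Set.Ioi 0, ∫⁻ q, ENNReal.ofReal
      ((√(1 + 2 * t * (a / e n)))⁻¹ ^ (e n - n) *
        Real.exp (-(t * s * q / (1 + 2 * t * (a / e n))))) ∂(μ n)) atTop
      (nhds (ENNReal.ofReal (1 / (κ * (a + s))))) := by
  have hinv : Tendsto (fun n => ((e n : ℝ))⁻¹) atTop (nhds 0) := tendsto_inv_atTop_zero.comp hE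
  set V : ℕ → ℝ := fun n => ∫ q, (q - ((e n : ℝ) - n) / e n) ^ 2 ∂(μ n) with hV
  have hV0 : Tendsto (fun n => √(V n)) atTop (nhds 0) := by
    rw [← Real.sqrt_zero]
    refine (Real.continuous_sqrt.tendsto 0).comp ?_
    have hub : Tendsto (fun n => 4 * ((r : ℝ) ^ 2 * ((e n : ℝ)⁻¹) ^ 2 + 2 * (e n : ℝ)⁻¹)) atTop
        (nhds 0) := by
      have := (((hinv.pow 2).const_mul ((r : ℝ) ^ 2)).add (hinv.const_mul 2)).const_mul 4
      simpa using this
    refine tendsto_of_tendsto_of_tendsto_of_le_of_le' tendsto_const_nhds hub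
      (Eventually.of_forall fun n => integral_nonneg fun _ => sq_nonneg _) ?_
    filter_upwards [hμ, hE.eventually_ge_atTop (2 * r + 1)] with n hn hr
    have hr0 : (0 : ℝ) ≤ r := Nat.cast_nonneg r
    have he : (0 : ℝ) < e n := by linarith
    have hVn : 0 ≤ V n := integral_nonneg fun _ => sq_nonneg _
    have h1 : ((e n : ℝ) / 2) ^ 2 ≤ ((e n : ℝ) - r) ^ 2 :=
      pow_le_pow_left₀ (by linarith) (by linarith) 2
    have h2 : ((e n : ℝ) / 2) ^ 2 * V n ≤ (r : ℝ) ^ 2 + 2 * e n :=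
      (mul_le_mul_of_nonneg_right h1 hVn).trans hn.2
    have h3 : 4 * ((r : ℝ) ^ 2 * ((e n : ℝ)⁻¹) ^ 2 + 2 * (e n : ℝ)⁻¹) =
        ((r : ℝ) ^ 2 + 2 * e n) / ((e n : ℝ) / 2) ^ 2 := by field_simp; norm_num
    rw [h3, le_div_iff₀ (by positivity), mul_comm]
    exact h2
  have hlim : ∫⁻ t in Set.Ioi 0, ENNReal.ofReal (Real.exp (-(κ * (a + s)) * t)) =
      ENNReal.ofReal (1 / (κ * (a + s))) := lintegral_exp_neg_mul_Ioi (by positivity)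
  rw [← hlim]
  refine tendsto_lintegral_filter_of_dominated_convergence
    (fun t => ENNReal.ofReal ((1 + (κ * a / 8 * t) ^ 2)⁻¹)) ?_ ?_ ?_ ?_
  · refine Eventually.of_forall fun n => ?_
    have := hprob n
    refine Measurable.lintegral_prod_right' (ν := μ n) (f := fun p : ℝ × ℝ => ENNReal.ofReal
      ((√(1 + 2 * p.1 * (a / e n)))⁻¹ ^ (e n - n) *
        Real.exp (-(p.1 * s * p.2 / (1 + 2 * p.1 * (a / e n)))))) ?_
    fun_prop
  · filter_upwards [hμ, eventually_inv_sqrt_pow_le hE hκ0 hκ hlt ha] with n hn hle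
    have := hprob n
    refine (ae_restrict_iff' measurableSet_Ioi).2 (ae_of_all _ fun t ht => ?_)
    have ht0 : 0 < t := ht
    calc _ ≤ ∫⁻ q, ENNReal.ofReal ((1 + (κ * a / 8 * t) ^ 2)⁻¹) ∂(μ n) := by
          refine lintegral_mono_ae ?_
          filter_upwards [hn.1] with q hq
          refine ENNReal.ofReal_le_ofReal ((mul_le_of_le_one_right (by positivity) ?_).trans
            (hle t ht0))
          refine Real.exp_le_one_iff.2 (neg_nonpos.2 ?_)
          have := hq.1
          positivity
      _ = _ := by simp
  · have hc : κ * a / 8 ≠ 0 := by positivity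
    have hint : Integrable (fun t : ℝ => (1 + (κ * a / 8 * t) ^ 2)⁻¹) :=
      integrable_inv_one_add_sq.comp_mul_left' hc
    exact (hint.integrableOn (s := Set.Ioi 0)).lintegral_lt_top.ne
  · refine (ae_restrict_iff' measurableSet_Ioi).2 (ae_of_all _ fun t ht => ?_)
    have ht0 : 0 < t := ht
    set u : ℕ → ℝ := fun n => t * s / (1 + 2 * t * (a / e n)) with hu
    have hu0 : ∀ n, 0 ≤ u n := fun n => by positivity
    have hulim : Tendsto u atTop (nhds (t * s)) := by
      have h1 : Tendsto (fun n => 1 + 2 * t * (a * (e n : ℝ)⁻¹)) atTop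
          (nhds (1 + 2 * t * (a * 0))) := ((hinv.const_mul a).const_mul (2 * t)).const_add 1
      have h2 : Tendsto (fun n => t * s / (1 + 2 * t * (a * (e n : ℝ)⁻¹))) atTop
          (nhds (t * s / (1 + 2 * t * (a * 0)))) := tendsto_const_nhds.div h1 (by simp)
      simpa [hu, div_eq_mul_inv] using h2
    have hmain : Tendsto (fun n => ∫ q, Real.exp (-(u n * q)) ∂(μ n)) atTop
        (nhds (Real.exp (-(t * s * κ)))) := by
      have h1 : Tendsto (fun n => Real.exp (-(u n * (((e n : ℝ) - n) / e n)))) atTop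
          (nhds (Real.exp (-(t * s * κ)))) :=
        (Real.continuous_exp.tendsto _).comp (hulim.mul hκ).neg
      have h2 : Tendsto (fun n => u n * √(V n)) atTop (nhds 0) := by
        simpa using hulim.mul hV0
      have h3 : Tendsto (fun n => (∫ q, Real.exp (-(u n * q)) ∂(μ n)) -
          Real.exp (-(u n * (((e n : ℝ) - n) / e n)))) atTop (nhds 0) := by
        refine squeeze_zero_norm' ?_ h2
        filter_upwards [hμ, hlt] with n hn hnlt
        have := hprob n
        refine abs_integral_exp_neg_mul_sub_le hn.1 (hu0 n) (div_nonneg ?_ (Nat.cast_nonneg _))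
        have : (n : ℝ) < e n := by exact_mod_cast hnlt
        linarith
      simpa using h3.add h1
    have hprod := ENNReal.tendsto_ofReal ((tendsto_inv_sqrt_pow hE hκ hlt ha ht0).mul hmain)
    have hlimeq : Real.exp (-(t * a * κ)) * Real.exp (-(t * s * κ)) =
        Real.exp (-(κ * (a + s)) * t) := by
      rw [← Real.exp_add]; ring_nf
    rw [hlimeq] at hprod
    refine hprod.congr' ?_
    filter_upwards [hμ] with n hn
    have := hprob n
    have hexp : Integrable (fun q => Real.exp (-(u n * q))) (μ n) := by
      refine Integrable.of_bound (C := 1) (by fun_prop) ?_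
      filter_upwards [hn.1] with q hq
      rw [Real.norm_eq_abs, abs_of_pos (Real.exp_pos _)]
      exact Real.exp_le_one_iff.2 (neg_nonpos.2 (mul_nonneg (hu0 n) hq.1))
    rw [← integral_const_mul, ofReal_integral_eq_lintegral_ofReal (hexp.const_mul _)
      (ae_of_all _ fun q => by positivity)]
    refine lintegral_congr fun q => ?_
    have : u n * q = t * s * q / (1 + 2 * t * (a / e n)) := by simp only [hu]; ring
    rw [this]

end

theorem trace_sq_mul_inv_sq_add {r : ℕ} {σ : Fin r → ℝ} (hσ : ∀ i, 0 < σ i) (a : ℝ) (ha : 0 < a) :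
    Matrix.trace (Matrix.diagonal σ ^ 2 *
      (Matrix.diagonal σ ^ 2 + a • (1 : Matrix (Fin r) (Fin r) ℝ))⁻¹) =
      ∑ j, σ j ^ 2 / (σ j ^ 2 + a) := by
  have h1 : Matrix.diagonal σ ^ 2 + a • (1 : Matrix (Fin r) (Fin r) ℝ) =
      Matrix.diagonal fun j => σ j ^ 2 + a := by
    rw [Matrix.diagonal_pow, Matrix.smul_one_eq_diagonal, Matrix.diagonal_add]
    rfl
  have h2 : (Matrix.diagonal fun j => σ j ^ 2 + a)⁻¹ =
      Matrix.diagonal fun j => (σ j ^ 2 + a)⁻¹ := by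
    refine Matrix.inv_eq_right_inv ?_
    rw [Matrix.diagonal_mul_diagonal, ← Matrix.diagonal_one]
    congr 1
    ext j
    exact mul_inv_cancel₀ (by have := hσ j; positivity)
  rw [h1, h2, Matrix.diagonal_pow, Matrix.diagonal_mul_diagonal, Matrix.trace_diagonal]
  rfl

theorem tendsto_integral_frobSq_Wmat {c η : ℝ} (hc : 1 < c) (hη : 0 < η) {r : ℕ} {σ : Fin r → ℝ}
    (hσ : ∀ i, 0 < σ i) {e : ℕ → ℕ}
    (he : Tendsto (fun n : ℕ => (e n : ℝ) / (n + 1 : ℕ)) atTop (nhds c))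
    {U : (n : ℕ) → Matrix (Fin (e n)) (Fin r) ℝ} (hU : ∀ n, r ≤ e n → (U n)ᵀ * U n = 1)
    {V : (n : ℕ) → Matrix (Fin (n + 1)) (Fin r) ℝ} (hV : ∀ n, r ≤ n + 1 → (V n)ᵀ * V n = 1) :
    Tendsto (fun n : ℕ => ∫ A, frobSq (Wmat (U n * Matrix.diagonal σ * (V n)ᵀ) A)
        ∂(gaussMatrix (e n) (n + 1) ((η ^ 2 / (e n : ℝ)).toNNReal)))
      atTop (nhds (c / (c - 1) * ∑ j, σ j ^ 2 / (σ j ^ 2 + η ^ 2))) := by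
  have hc0 : 0 < c := by linarith
  have hN : Tendsto (fun n : ℕ => ((n + 1 : ℕ) : ℝ)) atTop atTop :=
    tendsto_natCast_atTop_atTop.comp (tendsto_add_atTop_nat 1)
  have hE : Tendsto (fun n => (e n : ℝ)) atTop atTop := by
    refine (he.pos_mul_atTop hc0 hN).congr fun n => ?_
    have : ((n + 1 : ℕ) : ℝ) ≠ 0 := by positivity
    field_simp
  have hlt : ∀ᶠ n in atTop, n < e n := by
    filter_upwards [he.eventually (lt_mem_nhds hc)] with n hn
    have h0 : (0 : ℝ) < ((n + 1 : ℕ) : ℝ) := by positivity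
    rw [lt_div_iff₀ h0, one_mul] at hn
    have : n + 1 < e n := by exact_mod_cast hn
    omega
  set κ : ℝ := 1 - c⁻¹ with hκdef
  have hκ0 : 0 < κ := sub_pos.2 (inv_lt_one_of_one_lt₀ hc)
  have hκ : Tendsto (fun n => ((e n : ℝ) - n) / e n) atTop (nhds κ) := by
    have h1 := ((he.inv₀ hc0.ne').const_sub 1).add (tendsto_inv_atTop_zero.comp hE)
    rw [add_zero] at h1
    refine h1.congr' ?_
    filter_upwards [hlt] with n hn
    have h0 : (0 : ℝ) < e n := by exact_mod_cast (Nat.zero_le n).trans_lt hn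
    have h2 : ((n + 1 : ℕ) : ℝ) ≠ 0 := by positivity
    simp only [Function.comp_apply]
    rw [inv_div]
    push_cast
    field_simp
    ring
  have hr1 : ∀ᶠ n in atTop, r ≤ n + 1 := by
    filter_upwards [eventually_ge_atTop r] with n hn
    omega
  have hr2 : ∀ᶠ n in atTop, r ≤ e n := by
    filter_upwards [hE.eventually_ge_atTop (r : ℝ)] with n hn
    exact_mod_cast hn
  set v : ℕ → NNReal := fun n => (η ^ 2 / (e n : ℝ)).toNNReal with hv
  have hvc : ∀ n, (v n : ℝ) = η ^ 2 / e n := fun n => Real.coe_toNNReal _ (by positivity)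
  have hex : ∀ (j : Fin r) (n : ℕ), ∃ μ : Measure ℝ, IsProbabilityMeasure μ ∧
      ∀ (hn : r ≤ n + 1) (hd : r ≤ e n), n < e n → (∀ᵐ q ∂μ, 0 ≤ q ∧ q ≤ 1) ∧
      ((e n : ℝ) - r) ^ 2 * ∫ q, (q - ((e n : ℝ) - n) / e n) ^ 2 ∂μ ≤ (r : ℝ) ^ 2 + 2 * e n ∧
      ∫⁻ B, ENNReal.ofReal (((rectDiagonal hn hd σ + B) * (rectDiagonal hn hd σ + B)ᵀ)⁻¹
          (Fin.castLE hn j) (Fin.castLE hn j)) ∂(gaussMatrix (n + 1) (e n) (v n)) =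
        ∫⁻ t in Set.Ioi 0, ∫⁻ q, ENNReal.ofReal
          ((√(1 + 2 * t * (η ^ 2 / e n)))⁻¹ ^ (e n - n) *
          Real.exp (-(t * σ j ^ 2 * q / (1 + 2 * t * (η ^ 2 / e n))))) ∂μ := by
    intro j n
    by_cases h : r ≤ n + 1 ∧ r ≤ e n ∧ n < e n
    · obtain ⟨hn, hd, hnd⟩ := h
      have h0 : (0 : ℝ) < e n := by exact_mod_cast (Nat.zero_le n).trans_lt hnd
      have hv0 : v n ≠ 0 := (Real.toNNReal_pos.2 (by positivity)).ne'
      obtain ⟨μ, h1, h2, h3, h4⟩ := exists_law_lintegral_gram_inv_diag hv0 hnd hn hd σ j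
      rw [hvc] at h4
      exact ⟨μ, h1, fun _ _ _ => ⟨h2, h3, h4⟩⟩
    · exact ⟨Measure.dirac 0, inferInstance, fun hn hd hnd => absurd ⟨hn, hd, hnd⟩ h⟩
  choose μ hprob hμ using hex
  have hL : ∀ j, Tendsto (fun n => ∫⁻ t in Set.Ioi 0, ∫⁻ q, ENNReal.ofReal
      ((√(1 + 2 * t * (η ^ 2 / e n)))⁻¹ ^ (e n - n) *
        Real.exp (-(t * σ j ^ 2 * q / (1 + 2 * t * (η ^ 2 / e n))))) ∂(μ j n)) atTop
      (nhds (ENNReal.ofReal (1 / (κ * (η ^ 2 + σ j ^ 2))))) := fun j => by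
    refine tendsto_lintegral_of_concentration (r := r) hE hκ0 hκ hlt (by positivity)
      (by have := hσ j; positivity) (μ j) (hprob j) ?_
    filter_upwards [hlt, hr1, hr2] with n h1 h2 h3
    exact ⟨(hμ j n h2 h3 h1).1, (hμ j n h2 h3 h1).2.1⟩
  have hsum := tendsto_finsetSum Finset.univ fun j _ =>
    ENNReal.Tendsto.const_mul (a := ENNReal.ofReal (σ j ^ 2)) (hL j) (Or.inr ENNReal.ofReal_ne_top)
  have hval : ∑ j, ENNReal.ofReal (σ j ^ 2) * ENNReal.ofReal (1 / (κ * (η ^ 2 + σ j ^ 2))) =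
      ENNReal.ofReal (c / (c - 1) * ∑ j, σ j ^ 2 / (σ j ^ 2 + η ^ 2)) := by
    rw [Finset.mul_sum, ENNReal.ofReal_sum_of_nonneg]
    · refine Finset.sum_congr rfl fun j _ => ?_
      rw [← ENNReal.ofReal_mul (sq_nonneg _)]
      congr 1
      have h1 : σ j ^ 2 + η ^ 2 ≠ 0 := by positivity
      have h2 : c - 1 ≠ 0 := by linarith
      have h3 : κ = (c - 1) / c := by rw [hκdef]; field_simp
      rw [h3, add_comm (η ^ 2)]
      field_simp
    · intro j _
      have : 0 < c - 1 := by linarith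
      positivity
  rw [hval] at hsum
  have hreal := (ENNReal.tendsto_toReal ENNReal.ofReal_ne_top).comp hsum
  rw [ENNReal.toReal_ofReal] at hreal
  · refine hreal.congr' ?_
    filter_upwards [hlt, hr1, hr2] with n h1 h2 h3
    refine Eq.symm ((integral_eq_lintegral_of_nonneg_ae (ae_of_all _ fun A => ?_)
      (measurable_frobSq_Wmat _).aestronglyMeasurable).trans ?_)
    · exact Finset.sum_nonneg fun _ _ => Finset.sum_nonneg fun _ _ => sq_nonneg _
    · rw [lintegral_frobSq_Wmat h2 h3 σ _ (hU n h3) (hV n h2)]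
      simp only [Function.comp_apply]
      congr 1
      exact Finset.sum_congr rfl fun j _ => by rw [← (hμ j n h2 h3 h1).2.2]
  · have : 0 < c - 1 := by linarith
    exact mul_nonneg (by positivity) (Finset.sum_nonneg fun j _ => by positivity)

/-- **Lemma (variance term, `c > 1`).**
Fix `c > 1`, `η_trn > 0`, `r`, and an invertible diagonal `r × r` matrix `Σ = S` with
positive diagonal entries.  For each `N`, let `d = d(N)` satisfy `d(N)/N → c`, let `A_N`
be a `d × N` random matrix with i.i.d. Gaussian entries of mean `0` and variance
`η_trn²/d`, let `U_N` be `d × r` with `U_Nᵀ U_N = I_r`, `V_N` be `N × r` with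
`V_Nᵀ V_N = I_r`, `X_N = U_N S V_Nᵀ`, and
`W_N = X_N ((X_N+A_N)ᵀ(X_N+A_N))⁻¹ (X_N+A_N)ᵀ`.  Then
`E[‖W_N‖_F²] → (c/(c-1)) · Tr(S² (S² + η_trn² I_r)⁻¹)` as `N → ∞`. -/
theorem stmt_15 (c ηtrn : ℝ) (hc : 1 < c) (hη : 0 < ηtrn) (r : ℕ) (hr : 0 < r)
    (S : Matrix (Fin r) (Fin r) ℝ) (σ : Fin r → ℝ) (hσ : ∀ i, 0 < σ i)
    (hSdiag : S = Matrix.diagonal σ)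
    (d : ℕ → ℕ) (hd : ∀ N, 0 < d N)
    (hdc : Tendsto (fun N : ℕ => (d N : ℝ) / N) atTop (nhds c))
    (U : (N : ℕ) → Matrix (Fin (d N)) (Fin r) ℝ)
    (hU : ∀ N, r ≤ d N → (U N)ᵀ * U N = 1)
    (V : (N : ℕ) → Matrix (Fin N) (Fin r) ℝ)
    (hV : ∀ N, r ≤ N → (V N)ᵀ * V N = 1) :
    Tendsto
      (fun N : ℕ => ∫ A, frobSq (Wmat (U N * S * (V N)ᵀ) A)
          ∂(gaussMatrix (d N) N ((ηtrn ^ 2 / (d N : ℝ)).toNNReal)))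
      atTop
      (nhds ((c / (c - 1)) *
        Matrix.trace (S ^ 2 * (S ^ 2 + (ηtrn ^ 2) • (1 : Matrix (Fin r) (Fin r) ℝ))⁻¹))) := by
  subst hSdiag
  rw [trace_sq_mul_inv_sq_add hσ _ (by positivity), ← tendsto_add_atTop_iff_nat 1]
  exact tendsto_integral_frobSq_Wmat hc hη hσ ((tendsto_add_atTop_iff_nat 1).2 hdc)
    (U := fun n => U (n + 1)) (fun n => hU (n + 1)) (V := fun n => V (n + 1)) fun n => hV (n + 1)
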